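/- Let k be an algebraically closed field of characteristic zero and let f ∈ M_d(k⟨x₁,…,x_g⟩) be an atom with f(0) = I_d (the evaluation of f at the zero tuple of scalars is the identity matrix). Then there exists n₀ ∈ ℕ such that for every n ≥ n₀ the commutative polynomial det f(gX^(n)) ∈ k[ξ] is irreducible. -/

import Mathlib

open Matrix MvPolynomial

noncomputable section

/-- Entrywise evaluation of a `d × d` matrix over the free algebra at a `g`-tuple of
`n × n` matrices over a commutative `k`-algebra `R`, as a `(dn) × (dn)` matrix. -/
def matEval {k : Type*} [CommRing k] {g d n : ℕ} {R : Type*} [CommRing R] [Algebra k R]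
    (f : Matrix (Fin d) (Fin d) (FreeAlgebra k (Fin g)))
    (X : Fin g → Matrix (Fin n) (Fin n) R) :
    Matrix (Fin d × Fin n) (Fin d × Fin n) R :=
  Matrix.of fun p q => (FreeAlgebra.lift k X (f p.1 q.1)) p.2 q.2

/-- Evaluation of a noncommutative polynomial at a `g`-tuple of matrices. -/
def scalarEval {k : Type*} [CommRing k] {g n : ℕ} {R : Type*} [CommRing R] [Algebra k R]
    (f : FreeAlgebra k (Fin g)) (X : Fin g → Matrix (Fin n) (Fin n) R) :
    Matrix (Fin n) (Fin n) R :=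
  FreeAlgebra.lift k X f

/-- An atom of a matrix ring: a non-invertible element that is not a product of two
non-invertible elements. -/
def MatAtom {R : Type*} [Ring R] {d : ℕ} (f : Matrix (Fin d) (Fin d) R) : Prop :=
  ¬IsUnit f ∧ ∀ u v : Matrix (Fin d) (Fin d) R, f = u * v → IsUnit u ∨ IsUnit v

/-- The block-diagonal sum `f ⊕ I_e`. -/
def dSum {R : Type*} [Ring R] {d : ℕ} (f : Matrix (Fin d) (Fin d) R) (e : ℕ) :
    Matrix (Fin (d + e)) (Fin (d + e)) R :=
  Matrix.reindex finSumFinEquiv finSumFinEquiv (Matrix.fromBlocks f 0 0 1)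

/-- Stable associativity of square matrices over a ring. -/
def StablyAssociated {R : Type*} [Ring R] {d₁ d₂ : ℕ}
    (f₁ : Matrix (Fin d₁) (Fin d₁) R) (f₂ : Matrix (Fin d₂) (Fin d₂) R) : Prop :=
  ∃ (e₁ e₂ : ℕ) (h : d₁ + e₁ = d₂ + e₂)
    (P Q : Matrix (Fin (d₁ + e₁)) (Fin (d₁ + e₁)) R),
    IsUnit P ∧ IsUnit Q ∧
      dSum f₁ e₁ = P * Matrix.reindex (finCongr h).symm (finCongr h).symm (dSum f₂ e₂) * Q

/-- A monic linear pencil as a matrix over the free algebra. -/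
def pencilMat {k : Type*} [CommRing k] {g d : ℕ} (A : Fin g → Matrix (Fin d) (Fin d) k) :
    Matrix (Fin d) (Fin d) (FreeAlgebra k (Fin g)) :=
  1 - ∑ j, (A j).map fun a => a • FreeAlgebra.ι k j

/-- The `g`-tuple of `n × n` generic matrices. -/
def genX (k : Type*) [CommRing k] (g n : ℕ) :
    Fin g → Matrix (Fin n) (Fin n) (MvPolynomial (Fin g × Fin n × Fin n) k) :=
  fun j => Matrix.of fun ι κ => MvPolynomial.X (j, ι, κ)

section WeakAlgorithm

open MonoidAlgebra

variable {k : Type*} [Field k] {α : Type*}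

/-- Elements of the monoid algebra of a free monoid supported on words of length `< N`. -/
def wordLengthLT (k : Type*) [Field k] (α : Type*) (N : ℕ) :
    AddSubgroup (MonoidAlgebra k (FreeMonoid α)) where
  carrier := {a | ∀ u : FreeMonoid α, N ≤ u.length → a.coeff u = 0}
  add_mem' := by
    intro a b ha hb u hu
    simp [ha u hu, hb u hu]
  zero_mem' := by intro u _; simp
  neg_mem' := by
    intro a ha u hu
    simp [ha u hu]

lemma mem_wordLengthLT {N : ℕ} {a : MonoidAlgebra k (FreeMonoid α)} :
    a ∈ wordLengthLT k α N ↔ ∀ u : FreeMonoid α, N ≤ u.length → a.coeff u = 0 := Iff.rfl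

/-- One more than the maximal length of a word in the support, and `0` for the zero element. -/
def wordSize (a : MonoidAlgebra k (FreeMonoid α)) : ℕ :=
  a.coeff.support.sup fun u => u.length + 1

lemma wordSize_le_iff {N : ℕ} {a : MonoidAlgebra k (FreeMonoid α)} :
    wordSize a ≤ N ↔ a ∈ wordLengthLT k α N := by
  rw [wordSize, Finset.sup_le_iff, mem_wordLengthLT]
  constructor
  · intro h u hu
    by_contra hne
    have := h u (by simpa using hne)
    omega
  · intro h u hu
    by_contra hlt
    exact (by simpa using hu : a.coeff u ≠ 0) (h u (by omega))

lemma wordSize_eq_zero {a : MonoidAlgebra k (FreeMonoid α)} : wordSize a = 0 ↔ a = 0 := by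
  rw [← Nat.le_zero, wordSize_le_iff, mem_wordLengthLT]
  constructor
  · intro h
    ext u
    simpa using h u (Nat.zero_le _)
  · rintro rfl u _
    simp

lemma length_lt_wordSize {a : MonoidAlgebra k (FreeMonoid α)} {u : FreeMonoid α}
    (hu : u ∈ a.coeff.support) : u.length < wordSize a :=
  Nat.lt_of_succ_le (Finset.le_sup (f := fun u : FreeMonoid α => u.length + 1) hu)

lemma exists_length_add_one_eq_wordSize {a : MonoidAlgebra k (FreeMonoid α)} (ha : a ≠ 0) :
    ∃ u ∈ a.coeff.support, u.length + 1 = wordSize a := by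
  have hne : a.coeff.support.Nonempty := by
    rw [Finset.nonempty_iff_ne_empty]
    simpa using ha
  obtain ⟨u, hu, h⟩ := Finset.exists_mem_eq_sup _ hne (fun u : FreeMonoid α => u.length + 1)
  exact ⟨u, hu, h.symm⟩

/-- Strip the suffix `w` from every word, discarding the words without this suffix. -/
def stripSuffix (w : FreeMonoid α) :
    MonoidAlgebra k (FreeMonoid α) →+ MonoidAlgebra k (FreeMonoid α) :=
  comapDomainAddMonoidHom (R := k) (· * w) (mul_left_injective w)

lemma coeff_stripSuffix (w u : FreeMonoid α) (a : MonoidAlgebra k (FreeMonoid α)) :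
    (stripSuffix w a).coeff u = a.coeff (u * w) := by
  simp [stripSuffix, MonoidAlgebra.comapDomain]

lemma stripSuffix_single_mul_single (w v c : FreeMonoid α) (x y : k) (N : ℕ)
    (h : c.length < w.length → v.length + c.length < N + w.length) :
    stripSuffix w (MonoidAlgebra.single v x * MonoidAlgebra.single c y) -
      single v x * stripSuffix w (single c y)
      ∈ wordLengthLT k α N := by
  classical
  rw [single_mul_single]
  by_cases hc : ∃ c', c = c' * w
  · obtain ⟨c', rfl⟩ := hc
    have h1 : stripSuffix w (single (v * (c' * w)) (x * y)) = single (v * c') (x * y) := by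
      rw [← mul_assoc]; exact comapDomain_single_map (· * w) (mul_left_injective w) _ _
    have h2 : stripSuffix w (single (c' * w) y) = MonoidAlgebra.single c' y :=
      comapDomain_single_map (· * w) (mul_left_injective w) _ _
    rw [h1, h2, single_mul_single, sub_self]
    exact zero_mem _
  · have h2 : stripSuffix w (single c y) = 0 :=
      comapDomain_single_of_not_mem_range (by rintro ⟨c', h⟩; exact hc ⟨c', h.symm⟩)
        (mul_left_injective w)
    rw [h2, mul_zero, sub_zero]
    intro u hu
    rw [coeff_stripSuffix, coeff_single, Finsupp.single_apply, if_neg]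
    intro heq
    have hlen := congrArg FreeMonoid.length heq
    simp only [FreeMonoid.length_mul] at hlen
    by_cases hlt : c.length < w.length
    · have := h hlt
      omega
    · rcases List.append_eq_append_iff.mp (show FreeMonoid.toList v ++ FreeMonoid.toList c =
        FreeMonoid.toList u ++ FreeMonoid.toList w from heq) with ⟨s, hs1, hs2⟩ | ⟨s, hs1, hs2⟩
      · exact hc ⟨FreeMonoid.ofList s, hs2⟩
      · have hl := congrArg List.length hs2
        simp only [List.length_append] at hl
        have hs : s = [] := by
          have : s.length = 0 := by
            change w.length = s.length + c.length at hl
            omega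
          exact List.length_eq_zero_iff.mp this
        subst hs
        exact hc ⟨1, by simpa using hs2.symm⟩

lemma stripSuffix_mul_sub_mem (w : FreeMonoid α) (a c : MonoidAlgebra k (FreeMonoid α)) (N : ℕ)
    (h : ∀ v ∈ a.coeff.support, ∀ u ∈ c.coeff.support, u.length < w.length →
      v.length + u.length < N + w.length) :
    stripSuffix w (a * c) - a * stripSuffix w c ∈ wordLengthLT k α N := by
  have key : stripSuffix w (a * c) - a * stripSuffix w c =
      ∑ v ∈ a.coeff.support, ∑ u ∈ c.coeff.support,
        (stripSuffix w (single v (a.coeff v) * single u (c.coeff u)) -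
          single v (a.coeff v) * stripSuffix w (single u (c.coeff u))) := by
    conv_lhs => rw [← sum_coeff_single a, ← sum_coeff_single c]
    simp only [Finsupp.sum, Finset.sum_mul, Finset.mul_sum, map_sum, Finset.sum_sub_distrib]
    rw [Finset.sum_comm]
    congr 1
    rw [Finset.sum_comm]
  rw [key]
  exact sum_mem fun v hv => sum_mem fun u hu =>
    stripSuffix_single_mul_single w v u _ _ N (h v hv u hu)

lemma exists_wordSize_lt {ι : Type*} [Fintype ι] [DecidableEq ι]
    (a c : ι → MonoidAlgebra k (FreeMonoid α)) (hsum : ∑ i, a i * c i = 0)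
    (hne : ∃ i, a i ≠ 0 ∧ c i ≠ 0) :
    ∃ (i : ι) (d : ι → MonoidAlgebra k (FreeMonoid α)),
      wordSize (a i + ∑ j ∈ Finset.univ.erase i, a j * d j) < wordSize (a i) := by
  classical
  set s : Finset ι := Finset.univ.filter fun i => a i ≠ 0 ∧ c i ≠ 0 with hs
  have hsne : s.Nonempty := by
    obtain ⟨i, hi⟩ := hne
    exact ⟨i, by simp [hs, hi]⟩
  obtain ⟨i, his, hmax⟩ := Finset.exists_max_image s
    (fun i => toLex (wordSize (a i) + wordSize (c i), wordSize (a i))) hsne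
  have hi : a i ≠ 0 ∧ c i ≠ 0 := by simpa [hs] using his
  obtain ⟨w, hw, hwlen⟩ := exists_length_add_one_eq_wordSize hi.2
  have hA : 0 < wordSize (a i) := by
    rw [Nat.pos_iff_ne_zero, Ne, wordSize_eq_zero]; exact hi.1
  set γ := (c i).coeff w with hγ
  have hγ0 : γ ≠ 0 := by simpa using hw
  have hstrip : stripSuffix w (c i) = MonoidAlgebra.single 1 γ := by
    ext u
    rw [coeff_stripSuffix, coeff_single, Finsupp.single_apply]
    split_ifs with hu
    · subst hu; simp [hγ]
    · by_contra hne
      have h1 := length_lt_wordSize (a := c i) (u := u * w) (by simpa using hne)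
      rw [FreeMonoid.length_mul] at h1
      exact hu (FreeMonoid.length_eq_zero.mp (by omega)).symm
  have herr : ∀ j, stripSuffix w (a j * c j) - a j * stripSuffix w (c j)
      ∈ wordLengthLT k α (wordSize (a i) - 1) := by
    intro j
    apply stripSuffix_mul_sub_mem
    intro v hv u hu hlt
    have h1 := length_lt_wordSize hv
    have h2 := length_lt_wordSize hu
    have hj : j ∈ s := by
      simp only [hs, Finset.mem_filter, Finset.mem_univ, true_and]
      constructor
      · intro h0; simp [h0] at hv
      · intro h0; simp [h0] at hu
    have h3 := Prod.Lex.le_iff.mp (hmax j hj)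
    simp only [ofLex_toLex] at h3
    omega
  have hmem : ∑ j, a j * stripSuffix w (c j) ∈ wordLengthLT k α (wordSize (a i) - 1) := by
    have h1 : ∑ j, a j * stripSuffix w (c j) =
        -∑ j, (stripSuffix w (a j * c j) - a j * stripSuffix w (c j)) := by
      rw [Finset.sum_sub_distrib, ← map_sum, hsum, map_zero, zero_sub, neg_neg]
    rw [h1]
    exact neg_mem (sum_mem fun j _ => herr j)
  refine ⟨i, fun j => stripSuffix w (c j) * MonoidAlgebra.single 1 γ⁻¹, ?_⟩
  have h2 : a i + ∑ j ∈ Finset.univ.erase i, a j * (stripSuffix w (c j) *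
      MonoidAlgebra.single 1 γ⁻¹) = (∑ j, a j * stripSuffix w (c j)) *
        MonoidAlgebra.single 1 γ⁻¹ := by
    rw [← Finset.add_sum_erase _ _ (Finset.mem_univ i), add_mul, Finset.sum_mul, hstrip, mul_assoc,
      single_mul_single, one_mul, mul_inv_cancel₀ hγ0, ← MonoidAlgebra.one_def, mul_one]
    simp only [mul_assoc]
  rw [h2]
  have h3 : (∑ j, a j * stripSuffix w (c j)) * MonoidAlgebra.single 1 γ⁻¹ ∈
      wordLengthLT k α (wordSize (a i) - 1) := by
    intro u hu
    rw [coeff_mul_single_one, hmem u hu, zero_mul]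
  have := wordSize_le_iff.mpr h3
  omega

/-- Every unimodular row over the free algebra can be brought to a unit vector by an invertible
matrix acting from the right. -/
lemma exists_isUnit_vecMul_eq_single_of_monoidAlgebra {ι : Type*} [Fintype ι] [DecidableEq ι]
    (a b : ι → MonoidAlgebra k (FreeMonoid α)) (hab : ∑ i, a i * b i = 1) :
    ∃ (U : Matrix ι ι (MonoidAlgebra k (FreeMonoid α))) (i : ι), IsUnit U ∧
      a ᵥ* U = Pi.single i 1 := by
  induction hN : ∑ i, wordSize (a i) using Nat.strong_induction_on generalizing a b with
  | _ N ih =>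
  subst hN
  have hdom : ∀ {x y : MonoidAlgebra k (FreeMonoid α)}, x * y = 0 → x = 0 ∨ y = 0 := by
    intro x y h
    have hd : NoZeroDivisors (MonoidAlgebra k (FreeMonoid α)) :=
      (FreeAlgebra.equivMonoidAlgebraFreeMonoid (R := k) (X := α)).symm.toMulEquiv.noZeroDivisors
    exact mul_eq_zero.mp h
  by_cases hred : ∃ c : ι → MonoidAlgebra k (FreeMonoid α), ∑ i, a i * c i = 0 ∧
      ∃ i, a i ≠ 0 ∧ c i ≠ 0
  · obtain ⟨c, hc, hne⟩ := hred
    obtain ⟨i, d, hlt⟩ := exists_wordSize_lt a c hc hne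
    set T : Matrix ι ι (MonoidAlgebra k (FreeMonoid α)) :=
      1 + Matrix.of fun j l => if l = i ∧ j ≠ i then d j else 0 with hT
    set T' : Matrix ι ι (MonoidAlgebra k (FreeMonoid α)) :=
      1 - Matrix.of fun j l => if l = i ∧ j ≠ i then d j else 0 with hT'
    have hsq : (Matrix.of fun j l => if l = i ∧ j ≠ i then d j else 0 :
        Matrix ι ι (MonoidAlgebra k (FreeMonoid α))) *
        (Matrix.of fun j l => if l = i ∧ j ≠ i then d j else 0) = 0 := by
      refine Matrix.ext fun j l => ?_
      rw [Matrix.mul_apply]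
      apply Finset.sum_eq_zero
      intro m _
      simp only [Matrix.of_apply]
      by_cases hm : m = i <;> simp [hm]
    have hTT' : T * T' = 1 := by
      rw [hT, hT', add_mul, mul_sub, mul_sub, hsq]; simp
    have hT'T : T' * T = 1 := by
      rw [hT, hT', sub_mul, mul_add, mul_add, hsq]; simp
    have haT : a ᵥ* T = Function.update a i (a i + ∑ j ∈ Finset.univ.erase i, a j * d j) := by
      funext l
      rw [hT, Matrix.vecMul_add, Matrix.vecMul_one, Pi.add_apply]
      by_cases hl : l = i
      · subst hl
        rw [Function.update_self]
        congr 1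
        simp only [Matrix.vecMul, dotProduct, Matrix.of_apply, true_and]
        rw [← Finset.add_sum_erase _ _ (Finset.mem_univ l)]
        simp only [ne_eq, not_true_eq_false, if_false, mul_zero, zero_add]
        exact Finset.sum_congr rfl fun j hj => by rw [if_pos (Finset.ne_of_mem_erase hj)]
      · rw [Function.update_of_ne hl]
        simp [Matrix.vecMul, dotProduct, hl]
    obtain ⟨U, i', hU, hrow⟩ := ih _ (by
      calc ∑ l, wordSize ((a ᵥ* T) l) < ∑ l, wordSize (a l) := by
            apply Finset.sum_lt_sum
            · intro l _
              rw [haT]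
              by_cases hl : l = i
              · subst hl; rw [Function.update_self]; exact hlt.le
              · rw [Function.update_of_ne hl]
            · exact ⟨i, Finset.mem_univ i, by rw [haT, Function.update_self]; exact hlt⟩)
      (a ᵥ* T) (T' *ᵥ b) (by
        change (a ᵥ* T) ⬝ᵥ (T' *ᵥ b) = 1
        rw [Matrix.dotProduct_mulVec, Matrix.vecMul_vecMul, hTT', Matrix.vecMul_one]
        exact hab) rfl
    exact ⟨T * U, i', (isUnit_iff_exists.mpr ⟨T', hTT', hT'T⟩).mul hU, by
      rw [← Matrix.vecMul_vecMul, hrow]⟩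
  · push Not at hred
    have hex : ∃ i, a i ≠ 0 := by
      by_contra! h
      simp [h] at hab
    obtain ⟨i, hi⟩ := hex
    have hrel : ∀ i j, a i ≠ 0 → a j ≠ 0 → b j * a i - (if j = i then 1 else 0) = 0 := by
      intro i j hi hj
      refine hred (fun j => b j * a i - (if j = i then 1 else 0)) ?_ j hj
      simp only [mul_sub, Finset.sum_sub_distrib, ← mul_assoc, ← Finset.sum_mul, hab, one_mul]
      simp
    have hone : ∀ j, j ≠ i → a j = 0 := by
      intro j hji
      by_contra hj
      have h1 := hrel i j hi hj
      rw [if_neg hji, sub_zero] at h1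
      have h2 := hrel j j hj hj
      rw [if_pos rfl, sub_eq_zero] at h2
      rcases hdom h1 with h | h
      · rw [h, zero_mul] at h2; exact zero_ne_one h2
      · exact hi h
    have hba : b i * a i = 1 := by
      have := hrel i i hi hi
      rwa [if_pos rfl, sub_eq_zero] at this
    have hab' : a i * b i = 1 := by
      rw [← hab, Finset.sum_eq_single i]
      · intro j _ hj; rw [hone j hj, zero_mul]
      · simp
    refine ⟨Matrix.diagonal (Function.update 1 i (b i)), i, ?_, ?_⟩
    · refine isUnit_iff_exists.mpr
        ⟨Matrix.diagonal (Function.update 1 i (a i)), ?_, ?_⟩ <;>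
      · rw [Matrix.diagonal_mul_diagonal, ← Matrix.diagonal_one]
        congr 1
        funext j
        by_cases hj : j = i
        · subst hj; simp [hab', hba]
        · simp [hj]
    · funext j
      rw [Matrix.vecMul_diagonal]
      by_cases hj : j = i
      · subst hj; simp [hab']
      · simp [hj, hone j hj]

end WeakAlgorithm

section BlockUnits

variable {S : Type*} [Ring S] {m n : Type*} [Fintype m] [Fintype n] [DecidableEq m] [DecidableEq n]

lemma isUnit_fromBlocks_diag_one {A : Matrix m m S} :
    IsUnit (fromBlocks A 0 0 (1 : Matrix n n S)) ↔ IsUnit A := by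
  constructor
  · intro h
    obtain ⟨W, h1, h2⟩ := isUnit_iff_exists.mp h
    rw [← fromBlocks_toBlocks W, fromBlocks_multiply, ← fromBlocks_one, fromBlocks_inj] at h1 h2
    exact isUnit_iff_exists.mpr ⟨W.toBlocks₁₁, by simpa using h1.1, by simpa using h2.1⟩
  · intro h
    obtain ⟨B, h1, h2⟩ := isUnit_iff_exists.mp h
    refine isUnit_iff_exists.mpr ⟨fromBlocks B 0 0 1, ?_, ?_⟩ <;>
      simp [fromBlocks_multiply, h1, h2]

lemma isUnit_fromBlocks_one_diag {A : Matrix n n S} :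
    IsUnit (fromBlocks (1 : Matrix m m S) 0 0 A) ↔ IsUnit A := by
  constructor
  · intro h
    obtain ⟨W, h1, h2⟩ := isUnit_iff_exists.mp h
    rw [← fromBlocks_toBlocks W, fromBlocks_multiply, ← fromBlocks_one, fromBlocks_inj] at h1 h2
    exact isUnit_iff_exists.mpr ⟨W.toBlocks₂₂, by simpa using h1.2.2.2, by simpa using h2.2.2.2⟩
  · intro h
    obtain ⟨B, h1, h2⟩ := isUnit_iff_exists.mp h
    refine isUnit_iff_exists.mpr ⟨fromBlocks 1 0 0 B, ?_, ?_⟩ <;>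
      simp [fromBlocks_multiply, h1, h2]

lemma isUnit_fromBlocks_unipotent_upper (B : Matrix m n S) :
    IsUnit (fromBlocks (1 : Matrix m m S) B 0 (1 : Matrix n n S)) := by
  refine isUnit_iff_exists.mpr ⟨fromBlocks 1 (-B) 0 1, ?_, ?_⟩ <;>
    simp [fromBlocks_multiply]

lemma isUnit_fromBlocks_unipotent_lower (B : Matrix n m S) :
    IsUnit (fromBlocks (1 : Matrix m m S) 0 B (1 : Matrix n n S)) := by
  refine isUnit_iff_exists.mpr ⟨fromBlocks 1 0 (-B) 1, ?_, ?_⟩ <;>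
    simp [fromBlocks_multiply]

lemma isUnit_fromBlocks_upper_one {A : Matrix m m S} {B : Matrix m n S} :
    IsUnit (fromBlocks A B 0 (1 : Matrix n n S)) ↔ IsUnit A := by
  have h : fromBlocks A B 0 (1 : Matrix n n S) = fromBlocks 1 B 0 1 * fromBlocks A 0 0 1 := by
    simp [fromBlocks_multiply]
  rw [h, ← (isUnit_fromBlocks_unipotent_upper B).unit_spec, Units.isUnit_units_mul,
    isUnit_fromBlocks_diag_one]

lemma irreducible_of_irreducible_fromBlocks_diag_one {A : Matrix m m S}
    (h : Irreducible (fromBlocks A 0 0 (1 : Matrix n n S))) : Irreducible A := by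
  refine ⟨fun hA => h.not_isUnit (isUnit_fromBlocks_diag_one.mpr hA), fun u v huv => ?_⟩
  have := h.isUnit_or_isUnit (a := fromBlocks u 0 0 1) (b := fromBlocks v 0 0 1)
    (by simp [fromBlocks_multiply, huv])
  rwa [isUnit_fromBlocks_diag_one, isUnit_fromBlocks_diag_one] at this

lemma irreducible_of_irreducible_fromBlocks_one_diag {A : Matrix n n S}
    (h : Irreducible (fromBlocks (1 : Matrix m m S) 0 0 A)) : Irreducible A := by
  refine ⟨fun hA => h.not_isUnit (isUnit_fromBlocks_one_diag.mpr hA), fun u v huv => ?_⟩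
  have := h.isUnit_or_isUnit (a := fromBlocks 1 0 0 u) (b := fromBlocks 1 0 0 v)
    (by simp [fromBlocks_multiply, huv])
  rwa [isUnit_fromBlocks_one_diag, isUnit_fromBlocks_one_diag] at this

end BlockUnits

section Hermite

variable {k : Type*} [Field k] {α : Type*}

lemma exists_isUnit_vecMul_eq_single {ι : Type*} [Fintype ι] [DecidableEq ι]
    (a b : ι → FreeAlgebra k α) (hab : ∑ i, a i * b i = 1) (i : ι) :
    ∃ U : Matrix ι ι (FreeAlgebra k α), IsUnit U ∧ a ᵥ* U = Pi.single i 1 := by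
  let e := FreeAlgebra.equivMonoidAlgebraFreeMonoid (R := k) (X := α)
  obtain ⟨U, i', hU, h⟩ := exists_isUnit_vecMul_eq_single_of_monoidAlgebra
    (fun i => e (a i)) (fun i => e (b i)) (by simp only [← map_mul, ← map_sum, hab, map_one])
  have hrow : a ᵥ* (e.symm.toRingEquiv.mapMatrix U) = Pi.single i' 1 := by
    funext j
    have := congrArg e.symm (congrFun h j)
    simp only [Matrix.vecMul, dotProduct, map_sum, map_mul, AlgEquiv.symm_apply_apply] at this
    simp only [Matrix.vecMul, dotProduct]
    refine Eq.trans this ?_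
    by_cases hj : j = i'
    · subst hj; simp
    · simp [hj]
  have hperm : IsUnit ((Equiv.swap i i').toPEquiv.toMatrix : Matrix ι ι (FreeAlgebra k α)) := by
    refine isUnit_iff_exists.mpr ⟨(Equiv.swap i i').toPEquiv.toMatrix, ?_, ?_⟩ <;>
    · rw [← PEquiv.toMatrix_trans, ← Equiv.toPEquiv_trans]
      simp
  refine ⟨e.symm.toRingEquiv.mapMatrix U * (Equiv.swap i i').toPEquiv.toMatrix,
    (hU.map e.symm.toRingEquiv.mapMatrix).mul hperm, ?_⟩
  rw [← Matrix.vecMul_vecMul, hrow]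
  funext j
  simp [Pi.single_apply, PEquiv.toMatrix_apply, Equiv.toPEquiv_apply, eq_comm]

variable {ι : Type*} [Fintype ι] [DecidableEq ι]

lemma irreducible_fromBlocks_diag_one_unit {f : Matrix ι ι (FreeAlgebra k α)}
    (hf : Irreducible f) :
    Irreducible (fromBlocks f 0 0 (1 : Matrix Unit Unit (FreeAlgebra k α))) := by
  refine ⟨fun h => hf.not_isUnit (isUnit_fromBlocks_diag_one.mp h), fun G H hGH => ?_⟩
  obtain ⟨U, hU, hrow⟩ := exists_isUnit_vecMul_eq_single (G (Sum.inr ()))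
    (fun j => H j (Sum.inr ()))
    (by
      have := congrFun (congrFun hGH (Sum.inr ())) (Sum.inr ())
      rw [Matrix.mul_apply] at this
      rw [← this]; simp) (Sum.inr ())
  obtain ⟨W, hUW, hWU⟩ := isUnit_iff_exists.mp hU
  have h21 : (G * U).toBlocks₂₁ = 0 := by
    ext i j : 2
    have := congrFun hrow (Sum.inl j)
    simpa [Matrix.toBlocks₂₁, Matrix.mul_apply, Matrix.vecMul, dotProduct] using this
  have h22 : (G * U).toBlocks₂₂ = 1 := by
    ext i j : 2
    have := congrFun hrow (Sum.inr j)
    simpa [Matrix.toBlocks₂₂, Matrix.mul_apply, Matrix.vecMul, dotProduct] using this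
  have hprod : fromBlocks f 0 0 (1 : Matrix Unit Unit (FreeAlgebra k α)) = (G * U) * (W * H) := by
    rw [hGH, Matrix.mul_assoc, ← Matrix.mul_assoc U, hUW, Matrix.one_mul]
  rw [← fromBlocks_toBlocks (G * U), ← fromBlocks_toBlocks (W * H), h21, h22,
    fromBlocks_multiply, fromBlocks_inj] at hprod
  simp only [Matrix.zero_mul, Matrix.one_mul, zero_add] at hprod
  obtain ⟨h1, -, h3, h4⟩ := hprod
  rw [← h3, Matrix.mul_zero, add_zero] at h1
  have hW : IsUnit W := isUnit_iff_exists.mpr ⟨U, hWU, hUW⟩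
  rcases hf.isUnit_or_isUnit h1 with h | h
  · left
    have : IsUnit (G * U) := by
      rw [← fromBlocks_toBlocks (G * U), h21, h22]
      exact isUnit_fromBlocks_upper_one.mpr h
    rwa [← hU.unit_spec, Units.isUnit_mul_units] at this
  · right
    have : IsUnit (W * H) := by
      rw [← fromBlocks_toBlocks (W * H), ← h3, ← h4]
      exact isUnit_fromBlocks_upper_one.mpr h
    rwa [← hW.unit_spec, Units.isUnit_units_mul] at this

lemma irreducible_reindex {S m n : Type*} [Ring S] [Fintype m] [Fintype n] [DecidableEq m]
    [DecidableEq n] (e : m ≃ n) {A : Matrix m m S} (hA : Irreducible A) :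
    Irreducible (Matrix.reindex e e A) :=
  (MulEquiv.irreducible_iff (Matrix.reindexRingEquiv S e)).mpr hA

lemma irreducible_fromBlocks_diag_one {f : Matrix ι ι (FreeAlgebra k α)} (hf : Irreducible f)
    (κ : Type*) [Fintype κ] [DecidableEq κ] :
    Irreducible (fromBlocks f 0 0 (1 : Matrix κ κ (FreeAlgebra k α))) := by
  suffices h : ∀ (κ : Type _) [Fintype κ], ∀ _ : DecidableEq κ,
      Irreducible (fromBlocks f 0 0 (1 : Matrix κ κ (FreeAlgebra k α))) from h κ _
  intro κ _
  refine Fintype.induction_empty_option (P := fun κ _ => ∀ _ : DecidableEq κ,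
    Irreducible (fromBlocks f 0 0 (1 : Matrix κ κ (FreeAlgebra k α)))) ?_ ?_ ?_ κ
  · intro κ κ' _ e ih _
    let _ := Fintype.ofEquiv κ' e.symm
    classical
    convert irreducible_reindex (Equiv.sumCongr (Equiv.refl ι) e) (ih (Classical.decEq _)) using 1
    ext (i | i) (j | j) : 2 <;> simp [Matrix.one_apply]
  · intro _
    convert irreducible_reindex (Equiv.sumEmpty ι PEmpty).symm hf using 1
    ext (i | i) (j | j) : 2
    · simp
    · exact j.elim
    · exact i.elim
    · exact i.elim
  · intro κ _ ih _
    classical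
    convert irreducible_reindex ((Equiv.sumAssoc ι κ Unit).trans
      (Equiv.sumCongr (Equiv.refl ι) (Equiv.optionEquivSumPUnit κ).symm))
      (irreducible_fromBlocks_diag_one_unit (ih (Classical.decEq _))) using 1
    ext (i | _ | i) (j | _ | j) : 2 <;> simp [Matrix.one_apply]

end Hermite

section Evaluation

variable {R : Type*} [CommRing R] {g : ℕ} {S : Type*} [CommRing S] [Algebra R S]
  {ι κ n : Type*} [Fintype ι] [DecidableEq ι] [Fintype κ] [DecidableEq κ] [Fintype n]
  [DecidableEq n]

/-- Entrywise evaluation of matrices over the free algebra at a tuple of matrices. -/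
def matEvalHom (ι : Type*) [Fintype ι] [DecidableEq ι] (X : Fin g → Matrix n n S) :
    Matrix ι ι (FreeAlgebra R (Fin g)) →+* Matrix (ι × n) (ι × n) S :=
  (Matrix.compRingEquiv ι n S).toRingHom.comp (FreeAlgebra.lift R X).toRingHom.mapMatrix

lemma matEvalHom_apply (X : Fin g → Matrix n n S) (f : Matrix ι ι (FreeAlgebra R (Fin g)))
    (p q : ι × n) :
    matEvalHom ι X f p q = FreeAlgebra.lift R X (f p.1 q.1) p.2 q.2 := rfl

/-- The monic pencil `1 - ∑ A_j x_j` over the free algebra. -/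
def monicPencil (A : Fin g → Matrix ι ι R) : Matrix ι ι (FreeAlgebra R (Fin g)) :=
  1 - ∑ j, (A j).map fun a => a • FreeAlgebra.ι R j

/-- The value `1 - ∑ A_j ⊗ X_j` of a monic pencil. -/
def pencilEval (A : Fin g → Matrix ι ι R) (X : Fin g → Matrix n n S) :
    Matrix (ι × n) (ι × n) S :=
  1 - ∑ j, kroneckerMap (fun a x => a • x) (A j) (X j)

lemma matEvalHom_monicPencil (A : Fin g → Matrix ι ι R) (X : Fin g → Matrix n n S) :
    matEvalHom ι X (monicPencil A) = pencilEval A X := by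
  rw [monicPencil, pencilEval, map_sub, map_one, map_sum]
  congr 1
  refine Finset.sum_congr rfl fun j _ => ?_
  ext p q
  simp [matEvalHom_apply]

lemma det_matEvalHom_fromBlocks (X : Fin g → Matrix n n S)
    (f : Matrix ι ι (FreeAlgebra R (Fin g))) (b : Matrix ι κ (FreeAlgebra R (Fin g)))
    (h : Matrix κ κ (FreeAlgebra R (Fin g))) :
    (matEvalHom (ι ⊕ κ) X (fromBlocks f b 0 h)).det =
      (matEvalHom ι X f).det * (matEvalHom κ X h).det := by
  rw [← Matrix.det_reindex_self (Equiv.sumProdDistrib ι κ n),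
    ← Matrix.det_fromBlocks_zero₂₁ _
      (Matrix.of fun (p : ι × n) (q : κ × n) => FreeAlgebra.lift R X (b p.1 q.1) p.2 q.2)]
  congr 1
  ext (p | p) (q | q) <;> simp [matEvalHom_apply]

lemma associated_det_of_isUnit_mul (X : Fin g → Matrix n n S)
    {P f Q f' : Matrix ι ι (FreeAlgebra R (Fin g))} (hP : IsUnit P) (hQ : IsUnit Q)
    (h : P * f * Q = f') :
    Associated (matEvalHom ι X f).det (matEvalHom ι X f').det := by
  rw [← h, map_mul, map_mul, det_mul, det_mul]
  have hP' := (Matrix.isUnit_iff_isUnit_det _).mp (hP.map (matEvalHom ι X))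
  have hQ' := (Matrix.isUnit_iff_isUnit_det _).mp (hQ.map (matEvalHom ι X))
  rw [mul_right_comm, mul_comm]
  exact associated_mul_unit_right _ _ (hP'.mul hQ')

end Evaluation

section Linearization

variable {R : Type*} [CommRing R] {g : ℕ}

/-- The span of `1` and the variables in the free algebra. -/
def degreeLEOne (R : Type*) [CommRing R] (g : ℕ) : Submodule R (FreeAlgebra R (Fin g)) :=
  Submodule.span R (insert 1 (Set.range (FreeAlgebra.ι R)))

lemma one_le_degreeLEOne : 1 ≤ degreeLEOne R g := by
  rw [Submodule.one_le]
  exact Submodule.subset_span (Set.mem_insert _ _)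

lemma degreeLEOne_pow_mono {r s : ℕ} (h : r ≤ s) : degreeLEOne R g ^ r ≤ degreeLEOne R g ^ s :=
  pow_le_pow_right' one_le_degreeLEOne h

lemma ι_mem_degreeLEOne (j : Fin g) : FreeAlgebra.ι R j ∈ degreeLEOne R g :=
  Submodule.subset_span (Set.mem_insert_of_mem _ ⟨j, rfl⟩)

lemma algebraMap_mem_degreeLEOne (a : R) : algebraMap R _ a ∈ degreeLEOne R g := by
  rw [Algebra.algebraMap_eq_smul_one]
  exact Submodule.smul_mem _ _ (Submodule.subset_span (Set.mem_insert _ _))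

lemma exists_mem_degreeLEOne_pow (y : FreeAlgebra R (Fin g)) :
    ∃ r, y ∈ degreeLEOne R g ^ r := by
  induction y using FreeAlgebra.induction with
  | grade0 a => exact ⟨1, by simpa using algebraMap_mem_degreeLEOne a⟩
  | grade1 j => exact ⟨1, by simpa using ι_mem_degreeLEOne j⟩
  | mul a b ha hb =>
    obtain ⟨r, hr⟩ := ha
    obtain ⟨s, hs⟩ := hb
    exact ⟨r + s, by rw [pow_add]; exact Submodule.mul_mem_mul hr hs⟩
  | add a b ha hb =>
    obtain ⟨r, hr⟩ := ha
    obtain ⟨s, hs⟩ := hb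
    exact ⟨max r s, add_mem (degreeLEOne_pow_mono (le_max_left _ _) hr)
      (degreeLEOne_pow_mono (le_max_right _ _) hs)⟩

lemma exists_eq_add_sum_of_mem_degreeLEOne_mul (N : Submodule R (FreeAlgebra R (Fin g)))
    {y : FreeAlgebra R (Fin g)} (hy : y ∈ degreeLEOne R g * N) :
    ∃ y₀ ∈ N, ∃ z : Fin g → FreeAlgebra R (Fin g), (∀ j, z j ∈ N) ∧
      y = y₀ + ∑ j, FreeAlgebra.ι R j * z j := by
  classical
  induction hy using Submodule.mul_induction_on' with
  | mem_mul_mem v hv b hb =>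
    induction hv using Submodule.span_induction with
    | mem v hv =>
      rcases hv with rfl | ⟨j, rfl⟩
      · exact ⟨b, hb, 0, fun _ => N.zero_mem, by simp⟩
      · refine ⟨0, N.zero_mem, Pi.single j b, fun l => ?_, ?_⟩
        · by_cases h : l = j
          · subst h; simpa using hb
          · simp [h]
        · simp [Pi.single_apply]
    | zero => exact ⟨0, N.zero_mem, 0, fun _ => N.zero_mem, by simp⟩
    | add v w _ _ hv hw =>
      obtain ⟨y, hy, z, hz, e⟩ := hv
      obtain ⟨y', hy', z', hz', e'⟩ := hw
      refine ⟨y + y', add_mem hy hy', z + z', fun j => add_mem (hz j) (hz' j), ?_⟩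
      rw [add_mul, e, e']
      simp only [Pi.add_apply, mul_add, Finset.sum_add_distrib]
      abel
    | smul a v _ hv =>
      obtain ⟨y, hy, z, hz, e⟩ := hv
      refine ⟨a • y, N.smul_mem _ hy, a • z, fun j => N.smul_mem _ (hz j), ?_⟩
      rw [smul_mul_assoc, e, smul_add, Finset.smul_sum]
      simp
  | add v _ w _ hv hw =>
      obtain ⟨y, hy, z, hz, e⟩ := hv
      obtain ⟨y', hy', z', hz', e'⟩ := hw
      refine ⟨y + y', add_mem hy hy', z + z', fun j => add_mem (hz j) (hz' j), ?_⟩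
      rw [e, e']
      simp only [Pi.add_apply, mul_add, Finset.sum_add_distrib]
      abel

lemma exists_eq_algebraMap_add_sum_of_mem_degreeLEOne {y : FreeAlgebra R (Fin g)}
    (hy : y ∈ degreeLEOne R g) :
    ∃ (a : R) (b : Fin g → R), y = algebraMap R _ a + ∑ j, b j • FreeAlgebra.ι R j := by
  rw [← mul_one (degreeLEOne R g)] at hy
  obtain ⟨y₀, h₀, z, hz, rfl⟩ := exists_eq_add_sum_of_mem_degreeLEOne_mul 1 hy
  obtain ⟨a, rfl⟩ := Submodule.mem_one.mp h₀
  choose b hb using fun j => Submodule.mem_one.mp (hz j)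
  refine ⟨a, b, ?_⟩
  simp only [← hb, Algebra.smul_def, Algebra.commutes]

lemma exists_pencil_of_mem_degreeLEOne_pow (r : ℕ) :
    ∀ {ι : Type} [Fintype ι] [DecidableEq ι] (f : Matrix ι ι (FreeAlgebra R (Fin g))),
      (∀ i j, f i j ∈ degreeLEOne R g ^ (r + 1)) →
      ∃ (κ : Type) (_ : Fintype κ) (_ : DecidableEq κ) (B : Matrix (ι ⊕ κ) (ι ⊕ κ) R)
        (M : Fin g → Matrix (ι ⊕ κ) (ι ⊕ κ) R)
        (P Q : Matrix (ι ⊕ κ) (ι ⊕ κ) (FreeAlgebra R (Fin g))), IsUnit P ∧ IsUnit Q ∧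
        P * fromBlocks f 0 0 1 * Q =
          B.map (algebraMap R _) + ∑ j, (M j).map fun a => a • FreeAlgebra.ι R j := by
  induction r with
  | zero =>
    intro ι _ _ f hf
    simp only [zero_add, pow_one] at hf
    choose a b hab using fun i j => exists_eq_algebraMap_add_sum_of_mem_degreeLEOne (hf i j)
    refine ⟨PEmpty, inferInstance, inferInstance, fromBlocks (Matrix.of a) 0 0 1,
      fun l => fromBlocks (Matrix.of fun i j => b i j l) 0 0 1, 1, 1, isUnit_one, isUnit_one, ?_⟩
    refine Matrix.ext fun i j => ?_
    rcases i with i | i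
    · rcases j with j | j
      · simp [hab, Matrix.sum_apply]
      · exact j.elim
    · exact i.elim
  | succ r ih =>
    intro ι _ _ f hf
    have hdec : ∀ i j, f i j ∈ degreeLEOne R g * degreeLEOne R g ^ (r + 1) := fun i j => by
      rw [← pow_succ']; exact hf i j
    choose f₀ h₀ z hz hfz using
      fun i j => exists_eq_add_sum_of_mem_degreeLEOne_mul _ (hdec i j)
    let b : Matrix ι (Fin g × ι) (FreeAlgebra R (Fin g)) :=
      Matrix.of fun i p => if i = p.2 then FreeAlgebra.ι R p.1 else 0
    let c : Matrix (Fin g × ι) ι (FreeAlgebra R (Fin g)) := Matrix.of fun p j => z p.2 j p.1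
    have hle : degreeLEOne R g ≤ degreeLEOne R g ^ (r + 1) := by
      simpa using degreeLEOne_pow_mono (R := R) (g := g) (Nat.le_add_left 1 r)
    have hfbc : f = Matrix.of f₀ + b * c := by
      refine Matrix.ext fun i j => ?_
      rw [hfz]
      simp [b, c, Matrix.mul_apply, Fintype.sum_prod_type]
    have hone : ∀ q : Prop, [Decidable q] →
        (if q then (1 : FreeAlgebra R (Fin g)) else 0) ∈ degreeLEOne R g ^ (r + 1) := by
      intro q _
      split_ifs
      · exact hle (Submodule.subset_span (Set.mem_insert _ _))
      · exact zero_mem _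
    obtain ⟨κ, _, _, B, M, P, Q, hP, hQ, hPQ⟩ := ih (fromBlocks (Matrix.of f₀) b (-c) 1) (by
      rintro (i | i) (j | j)
      · exact h₀ i j
      · simp only [fromBlocks_apply₁₂, b, Matrix.of_apply]
        split_ifs
        · exact hle (ι_mem_degreeLEOne _)
        · exact zero_mem _
      · exact neg_mem (hz _ _ _)
      · exact hone _)
    let e := Equiv.sumAssoc ι (Fin g × ι) κ
    let E := Matrix.reindexRingEquiv (FreeAlgebra R (Fin g)) e
    have hstep : fromBlocks (Matrix.of f₀) b (-c) 1 =
        fromBlocks 1 b 0 1 * fromBlocks f 0 0 1 * fromBlocks 1 0 (-c) 1 := by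
      simp [fromBlocks_multiply, hfbc]
    have hU : IsUnit (fromBlocks (fromBlocks 1 b 0 1) 0 0 1 :
        Matrix ((ι ⊕ Fin g × ι) ⊕ κ) ((ι ⊕ Fin g × ι) ⊕ κ) (FreeAlgebra R (Fin g))) :=
      isUnit_fromBlocks_diag_one.mpr (isUnit_fromBlocks_unipotent_upper _)
    have hV : IsUnit (fromBlocks (fromBlocks 1 0 (-c) 1) 0 0 1 :
        Matrix ((ι ⊕ Fin g × ι) ⊕ κ) ((ι ⊕ Fin g × ι) ⊕ κ) (FreeAlgebra R (Fin g))) :=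
      isUnit_fromBlocks_diag_one.mpr (isUnit_fromBlocks_unipotent_lower _)
    refine ⟨(Fin g × ι) ⊕ κ, inferInstance, inferInstance, Matrix.reindex e e B,
      fun j => Matrix.reindex e e (M j), E (P * fromBlocks (fromBlocks 1 b 0 1) 0 0 1),
      E (fromBlocks (fromBlocks 1 0 (-c) 1) 0 0 1 * Q), (hP.mul hU).map E, (hV.mul hQ).map E, ?_⟩
    have hF : (fromBlocks f 0 0 1 : Matrix (ι ⊕ ((Fin g × ι) ⊕ κ)) (ι ⊕ ((Fin g × ι) ⊕ κ)) _) =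
        E (fromBlocks (fromBlocks f 0 0 1) 0 0 1) := by
      refine Matrix.ext fun i j => ?_
      rcases i with i | i | i <;> rcases j with j | j | j <;>
        simp [E, e, Matrix.one_apply]
    rw [hF, ← map_mul, ← map_mul]
    have hmid : P * fromBlocks (fromBlocks 1 b 0 1) 0 0 1 * fromBlocks (fromBlocks f 0 0 1) 0 0 1 *
        (fromBlocks (fromBlocks 1 0 (-c) 1) 0 0 1 * Q) =
        P * fromBlocks (fromBlocks (Matrix.of f₀) b (-c) 1) 0 0 1 * Q := by
      rw [hstep]
      have : (fromBlocks (fromBlocks 1 b 0 1 * fromBlocks f 0 0 1 * fromBlocks 1 0 (-c) 1) 0 0 1 :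
          Matrix ((ι ⊕ Fin g × ι) ⊕ κ) ((ι ⊕ Fin g × ι) ⊕ κ) (FreeAlgebra R (Fin g))) =
          fromBlocks (fromBlocks 1 b 0 1) 0 0 1 * fromBlocks (fromBlocks f 0 0 1) 0 0 1 *
            fromBlocks (fromBlocks 1 0 (-c) 1) 0 0 1 := by
        simp only [fromBlocks_multiply, Matrix.mul_zero, Matrix.zero_mul, add_zero, zero_add,
          Matrix.mul_one]
      rw [this]
      simp only [Matrix.mul_assoc]
    rw [hmid, hPQ, map_add, map_sum]
    rfl

variable {ι : Type} [Fintype ι] [DecidableEq ι]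

/-- A matrix over the free algebra with invertible constant term is stably associated to a
monic pencil. -/
lemma exists_monicPencil (f : Matrix ι ι (FreeAlgebra R (Fin g)))
    (hf : IsUnit (f.map (FreeAlgebra.lift R (fun _ : Fin g => (0 : R))))) :
    ∃ (κ : Type) (_ : Fintype κ) (_ : DecidableEq κ) (A : Fin g → Matrix (ι ⊕ κ) (ι ⊕ κ) R)
      (P Q : Matrix (ι ⊕ κ) (ι ⊕ κ) (FreeAlgebra R (Fin g))), IsUnit P ∧ IsUnit Q ∧
      P * fromBlocks f 0 0 1 * Q = monicPencil A := by
  obtain ⟨r, hr⟩ : ∃ r, ∀ i j, f i j ∈ degreeLEOne R g ^ (r + 1) := by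
    choose r hr using fun i j => exists_mem_degreeLEOne_pow (f i j)
    refine ⟨Finset.univ.sup fun p : ι × ι => r p.1 p.2, fun i j =>
      degreeLEOne_pow_mono (Nat.le_succ_of_le ?_) (hr i j)⟩
    exact Finset.le_sup (f := fun p : ι × ι => r p.1 p.2) (Finset.mem_univ (i, j))
  obtain ⟨κ, _, _, B, M, P, Q, hP, hQ, h⟩ := exists_pencil_of_mem_degreeLEOne_pow r f hr
  let ε := (FreeAlgebra.lift R (fun _ : Fin g => (0 : R))).toRingHom.mapMatrix (m := ι ⊕ κ)
  have hB : IsUnit B := by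
    have h1 := congrArg ε h
    have h2 : ε (B.map (algebraMap R _) + ∑ j, (M j).map fun a => a • FreeAlgebra.ι R j) = B := by
      refine Matrix.ext fun i j => ?_
      simp [ε, Matrix.sum_apply]
    have h3 : ε (fromBlocks f 0 0 1) =
        fromBlocks (f.map (FreeAlgebra.lift R (fun _ : Fin g => (0 : R)))) 0 0 1 := by
      refine Matrix.ext fun i j => ?_
      rcases i with i | i <;> rcases j with j | j
      · simp [ε]
      · simp [ε]
      · simp [ε]
      · by_cases h : i = j <;> simp [ε, h]
    rw [h2, map_mul, map_mul, h3] at h1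
    rw [← h1]
    exact ((hP.map ε).mul (isUnit_fromBlocks_diag_one.mpr hf)).mul (hQ.map ε)
  obtain ⟨B', hB1, hB2⟩ := isUnit_iff_exists.mp hB
  have hB' : IsUnit B' := isUnit_iff_exists.mpr ⟨B, hB2, hB1⟩
  refine ⟨κ, inferInstance, inferInstance, fun j => -(B' * M j),
    (algebraMap R (FreeAlgebra R (Fin g))).mapMatrix B' * P, Q,
    (hB'.map (algebraMap R (FreeAlgebra R (Fin g))).mapMatrix).mul hP, hQ, ?_⟩
  rw [Matrix.mul_assoc, Matrix.mul_assoc, ← Matrix.mul_assoc P, h, Matrix.mul_add]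
  rw [← RingHom.mapMatrix_apply, ← map_mul, hB2, map_one, monicPencil, sub_eq_add_neg,
    ← Finset.sum_neg_distrib, Matrix.mul_sum]
  congr 1
  refine Finset.sum_congr rfl fun j _ => Matrix.ext fun i l => ?_
  simp only [Matrix.mul_apply, Matrix.map_apply, Matrix.neg_apply, RingHom.mapMatrix_apply,
    Algebra.smul_def, map_neg, map_sum, map_mul, neg_mul, neg_neg, Finset.sum_mul, mul_assoc]

lemma associated_det_monicPencil {S n : Type*} [CommRing S] [Algebra R S] [Fintype n]
    [DecidableEq n] {κ : Type} [Fintype κ] [DecidableEq κ] (X : Fin g → Matrix n n S)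
    {f : Matrix ι ι (FreeAlgebra R (Fin g))} {A : Fin g → Matrix (ι ⊕ κ) (ι ⊕ κ) R}
    {P Q : Matrix (ι ⊕ κ) (ι ⊕ κ) (FreeAlgebra R (Fin g))} (hP : IsUnit P) (hQ : IsUnit Q)
    (h : P * fromBlocks f 0 0 1 * Q = monicPencil A) :
    Associated (matEvalHom ι X f).det (pencilEval A X).det := by
  have := associated_det_of_isUnit_mul X hP hQ h
  rwa [det_matEvalHom_fromBlocks, map_one, det_one, mul_one, matEvalHom_monicPencil] at this

end Linearization

section InvariantSubspaces

variable {k : Type*} [Field k] {g : ℕ}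

/-- A tuple of matrices without nontrivial common invariant subspaces. -/
def IsSimpleTuple {ι : Type*} [Fintype ι] (A : Fin g → Matrix ι ι k) : Prop :=
  ∀ W : Submodule k (ι → k), (∀ j, ∀ w ∈ W, A j *ᵥ w ∈ W) → W = ⊥ ∨ W = ⊤

variable {ι : Type} [Fintype ι] [DecidableEq ι]

lemma exists_blockTriangular_of_not_isSimpleTuple {A : Fin g → Matrix ι ι k}
    (hA : ¬ IsSimpleTuple A) :
    ∃ (p q : ℕ) (e : ι ≃ Fin p ⊕ Fin q) (P Q : Matrix ι ι k) (B : Fin g → Matrix (Fin p) (Fin p) k)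
      (C : Fin g → Matrix (Fin p) (Fin q) k) (D : Fin g → Matrix (Fin q) (Fin q) k),
      0 < p ∧ 0 < q ∧ P * Q = 1 ∧ Q * P = 1 ∧
      ∀ j, Matrix.reindex e e (Q * A j * P) = fromBlocks (B j) (C j) 0 (D j) := by
  simp only [IsSimpleTuple, not_forall, not_or] at hA
  obtain ⟨W, hW, hbot, htop⟩ := hA
  obtain ⟨W', hWW'⟩ := Submodule.exists_isCompl W
  let b := ((Module.finBasis k W).prod (Module.finBasis k W')).map
    (Submodule.prodEquivOfIsCompl W W' hWW')
  let e := (Pi.basisFun k ι).indexEquiv b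
  let b' := b.reindex e.symm
  let P := (Pi.basisFun k ι).toMatrix b'
  let Q := b'.toMatrix (Pi.basisFun k ι)
  refine ⟨_, _, e, P, Q, fun j => (Matrix.reindex e e (Q * A j * P)).toBlocks₁₁,
    fun j => (Matrix.reindex e e (Q * A j * P)).toBlocks₁₂,
    fun j => (Matrix.reindex e e (Q * A j * P)).toBlocks₂₂, ?_, ?_,
    Module.Basis.toMatrix_mul_toMatrix_flip _ _, Module.Basis.toMatrix_mul_toMatrix_flip _ _, ?_⟩
  · rw [Nat.pos_iff_ne_zero, Ne, Submodule.finrank_eq_zero]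
    exact hbot
  · rw [Nat.pos_iff_ne_zero, Ne, Submodule.finrank_eq_zero]
    rintro rfl
    exact htop (by simpa using hWW'.sup_eq_top)
  · intro j
    conv_lhs => rw [← fromBlocks_toBlocks (Matrix.reindex e e (Q * A j * P))]
    congr 1
    refine Matrix.ext fun i l => ?_
    have h1 : Q * A j * P = LinearMap.toMatrix b' b' (Matrix.toLin' (A j)) := by
      have := basis_toMatrix_mul_linearMap_toMatrix_mul_basis_toMatrix b' (Pi.basisFun k ι)
        b' (Pi.basisFun k ι) (Matrix.toLin' (A j))
      rwa [LinearMap.toMatrix_eq_toMatrix', LinearMap.toMatrix'_toLin'] at this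
    rw [h1]
    simp only [Matrix.toBlocks₂₁, Matrix.reindex_apply, Matrix.submatrix_apply, Matrix.of_apply,
      LinearMap.toMatrix_apply, Matrix.toLin'_apply, Matrix.zero_apply]
    have h2 : b' (e.symm (Sum.inl l)) = (Module.finBasis k W l : ι → k) := by
      simp [b', b]
    rw [h2]
    have h3 := hW j _ (Module.finBasis k W l).2
    simp only [b', b, Module.Basis.repr_reindex_apply, Module.Basis.map_repr, Equiv.symm_symm,
      LinearEquiv.trans_apply, Equiv.apply_symm_apply, Module.Basis.prod_repr_inr]
    rw [(Submodule.prodEquivOfIsCompl_symm_apply_snd_eq_zero W W' hWW').mpr h3]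
    simp

/-- A monic pencil irreducible over the free algebra is, up to units and base change, given by a
simple nonzero tuple. -/
lemma exists_isSimpleTuple {S : ℕ → Type*} [∀ n, CommRing (S n)] [∀ n, Algebra k (S n)]
    (X : ∀ n, Fin g → Matrix (Fin n) (Fin n) (S n)) (N : ℕ) :
    ∀ {ι : Type} [Fintype ι] [DecidableEq ι] (A : Fin g → Matrix ι ι k), Fintype.card ι = N →
      Irreducible (monicPencil A) →
      ∃ (κ : Type) (_ : Fintype κ) (_ : DecidableEq κ) (B : Fin g → Matrix κ κ k),
        IsSimpleTuple B ∧ (∃ j, B j ≠ 0) ∧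
        ∀ n, Associated (pencilEval A (X n)).det (pencilEval B (X n)).det := by
  induction N using Nat.strong_induction_on with
  | _ N ih =>
  intro ι _ _ A hN hA
  by_cases hs : IsSimpleTuple A
  · refine ⟨ι, inferInstance, inferInstance, A, hs, ?_, fun n => Associated.refl _⟩
    by_contra! h0
    refine hA.not_isUnit ?_
    have : A = 0 := funext h0
    subst this
    have : monicPencil (0 : Fin g → Matrix ι ι k) = 1 := by
      refine Matrix.ext fun i j => ?_
      simp [monicPencil]
    rw [this]
    exact isUnit_one
  obtain ⟨p, q, e, P, Q, B, C, D, hp, hq, hPQ, hQP, hblock⟩ :=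
    exists_blockTriangular_of_not_isSimpleTuple hs
  have hcard : p + q = N := by
    rw [← hN, Fintype.card_congr e]; simp
  let φ := (algebraMap k (FreeAlgebra k (Fin g))).mapMatrix (m := ι)
  have hP : IsUnit (φ P) := (isUnit_iff_exists.mpr ⟨Q, hPQ, hQP⟩ : IsUnit P).map φ
  have hQ : IsUnit (φ Q) := (isUnit_iff_exists.mpr ⟨P, hQP, hPQ⟩ : IsUnit Q).map φ
  let M : Matrix (Fin p) (Fin q) (FreeAlgebra k (Fin g)) :=
    -∑ j, (C j).map fun a => a • FreeAlgebra.ι k j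
  have hconj : φ Q * monicPencil A * φ P = monicPencil fun j => Q * A j * P := by
    simp only [monicPencil, Matrix.mul_sub, Matrix.sub_mul, Matrix.mul_one, Matrix.mul_sum,
      Matrix.sum_mul]
    rw [← map_mul φ, hQP, map_one]
    congr 1
    refine Finset.sum_congr rfl fun j _ => Matrix.ext fun i l => ?_
    have hc : ∀ c, FreeAlgebra.ι k j * algebraMap k _ c = algebraMap k _ c * FreeAlgebra.ι k j :=
      fun c => (Algebra.commutes c _).symm
    simp only [φ, Matrix.mul_apply, RingHom.mapMatrix_apply, Matrix.map_apply, Algebra.smul_def,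
      map_sum, map_mul, Finset.sum_mul, Finset.mul_sum, mul_assoc, hc]
    exact Finset.sum_comm
  have hre : Matrix.reindex e e (monicPencil fun j => Q * A j * P) =
      fromBlocks (monicPencil B) M 0 (monicPencil D) := by
    refine Matrix.ext fun i l => ?_
    have hentry : ∀ j, (Q * A j * P) (e.symm i) (e.symm l) =
        fromBlocks (B j) (C j) 0 (D j) i l := fun j => by rw [← hblock j]; rfl
    rcases i with i | i <;> rcases l with l | l <;>
      simp [monicPencil, M, Matrix.sum_apply, hentry, Matrix.one_apply]
  have hirr : Irreducible (fromBlocks (monicPencil B) M 0 (monicPencil D)) := by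
    rw [← hre]
    refine irreducible_reindex e ?_
    rw [← hconj, ← hP.unit_spec, ← hQ.unit_spec, irreducible_mul_units, irreducible_units_mul]
    exact hA
  have hdet : ∀ n, Associated (pencilEval A (X n)).det
      ((pencilEval B (X n)).det * (pencilEval D (X n)).det) := by
    intro n
    rw [← matEvalHom_monicPencil, ← matEvalHom_monicPencil, ← matEvalHom_monicPencil,
      ← det_matEvalHom_fromBlocks (X n) _ M, ← hre]
    have h1 := associated_det_of_isUnit_mul (X n) hQ hP hconj
    refine h1.trans (Associated.of_eq ?_)
    rw [← Matrix.det_reindex_self (Equiv.prodCongr e (Equiv.refl (Fin n)))]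
    congr 1
  have hfac : fromBlocks (monicPencil B) M 0 (monicPencil D) =
      fromBlocks 1 0 0 (monicPencil D) * fromBlocks 1 M 0 1 * fromBlocks (monicPencil B) 0 0 1 := by
    simp [fromBlocks_multiply]
  have hM := isUnit_fromBlocks_unipotent_upper M
  have hunit : ∀ {κ : Type} [Fintype κ] [DecidableEq κ] {E : Fin g → Matrix κ κ k},
      IsUnit (monicPencil E) → ∀ n, IsUnit (pencilEval E (X n)).det := by
    intro κ _ _ E hE n
    rw [← matEvalHom_monicPencil]
    exact (Matrix.isUnit_iff_isUnit_det _).mp (hE.map _)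
  rcases hirr.isUnit_or_isUnit hfac with h | h
  · rw [← hM.unit_spec, Units.isUnit_mul_units, isUnit_fromBlocks_one_diag] at h
    have hirrB : Irreducible (monicPencil B) := by
      have h' : IsUnit (fromBlocks 1 0 0 (monicPencil D) * fromBlocks
          (1 : Matrix (Fin p) (Fin p) (FreeAlgebra k (Fin g))) M 0 1) :=
        (isUnit_fromBlocks_one_diag.mpr h).mul hM
      rw [hfac, ← h'.unit_spec, irreducible_units_mul] at hirr
      exact irreducible_of_irreducible_fromBlocks_diag_one hirr
    obtain ⟨κ, _, _, E, hE, hE0, hass⟩ := ih p (by omega) B (by simp) hirrB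
    refine ⟨κ, inferInstance, inferInstance, E, hE, hE0, fun n => (hdet n).trans ?_⟩
    exact (associated_mul_unit_left _ _ (hunit h n)).trans (hass n)
  · have hirrD : Irreducible (monicPencil D) := by
      rw [hfac, ← h.unit_spec, ← hM.unit_spec, irreducible_mul_units, irreducible_mul_units] at hirr
      exact irreducible_of_irreducible_fromBlocks_one_diag hirr
    rw [isUnit_fromBlocks_diag_one] at h
    obtain ⟨κ, _, _, E, hE, hE0, hass⟩ := ih q (by omega) D (by simp) hirrD
    refine ⟨κ, inferInstance, inferInstance, E, hE, hE0, fun n => (hdet n).trans ?_⟩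
    exact (associated_unit_mul_left _ _ (hunit h n)).trans (hass n)

end InvariantSubspaces

section Burnside

variable {k : Type*} [Field k] {g : ℕ} {ι : Type} [Fintype ι] [DecidableEq ι]

/-- **Burnside's theorem**: a set of operators on a finite-dimensional vector space over an
algebraically closed field without nontrivial common invariant subspaces generates the full
endomorphism algebra. -/
lemma adjoin_eq_top_of_invariant_trivial [IsAlgClosed k] {V : Type*} [AddCommGroup V] [Module k V]
    [FiniteDimensional k V] (s : Set (Module.End k V))
    (hs : ∀ W : Submodule k V, (∀ T ∈ s, ∀ w ∈ W, T w ∈ W) → W = ⊥ ∨ W = ⊤) :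
    Algebra.adjoin k s = ⊤ := by
  rcases subsingleton_or_nontrivial V with hV | hV
  · exact (Algebra.eq_top_iff.mpr fun x => by
      rw [Subsingleton.elim x 0]; exact zero_mem _)
  let S := Algebra.adjoin k s
  have hsub : ∀ N : Submodule S V, N = ⊥ ∨ N = ⊤ := by
    intro N
    rcases hs (N.restrictScalars k) (fun T hT w hw =>
      N.smul_mem (⟨T, Algebra.subset_adjoin hT⟩ : S) hw) with h | h
    · exact Or.inl ((Submodule.restrictScalars_eq_bot_iff ..).mp h)
    · exact Or.inr ((Submodule.restrictScalars_eq_top_iff ..).mp h)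
  have : IsSimpleModule S V := { eq_bot_or_eq_top := hsub }
  have hend : ∀ f : Module.End S V, ∃ c : k, ∀ v, f v = c • v := by
    intro f
    obtain ⟨c, hc⟩ := Module.End.exists_eigenvalue (f.restrictScalars k)
    obtain ⟨v, hv, hv0⟩ := hc.exists_hasEigenvector
    refine ⟨c, fun w => ?_⟩
    rcases hsub (LinearMap.ker (f - algebraMap k (Module.End S V) c)) with h | h
    · exfalso
      refine hv0 ((Submodule.eq_bot_iff _).mp h v ?_)
      have := Module.End.mem_eigenspace_iff.mp hv
      simpa [sub_eq_zero] using this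
    · have := LinearMap.mem_ker.mp (h ▸ Submodule.mem_top (x := w))
      simpa [sub_eq_zero] using this
  refine Algebra.eq_top_iff.mpr fun T => ?_
  let T' : Module.End (Module.End S V) V :=
    { toFun := T
      map_add' := map_add T
      map_smul' := fun f v => by
        obtain ⟨c, hc⟩ := hend f
        simp [hc] }
  classical
  let b := Module.finBasis k V
  obtain ⟨r, hr⟩ := jacobson_density (R := S) T' (Finset.univ.image b)
  have : T = r := b.ext fun i => hr (b i) (by simp)
  rw [this]
  exact r.2

lemma IsSimpleTuple.exists_lift_eq [IsAlgClosed k] {A : Fin g → Matrix ι ι k}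
    (hA : IsSimpleTuple A) (T : Matrix ι ι k) :
    ∃ y : FreeAlgebra k (Fin g), FreeAlgebra.lift k A y = T := by
  have h := adjoin_eq_top_of_invariant_trivial
    (Set.range fun j => (Matrix.toLinAlgEquiv' (A j) : Module.End k (ι → k))) (fun W hW =>
      hA W fun j w hw => by simpa using hW _ ⟨j, rfl⟩ w hw)
  rw [Algebra.adjoin_range_eq_range_freeAlgebra_lift] at h
  obtain ⟨y, hy⟩ := (Algebra.eq_top_iff.mp h) (Matrix.toLinAlgEquiv' T)
  refine ⟨y, Matrix.toLinAlgEquiv'.injective ?_⟩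
  rw [← hy]
  have : (Matrix.toLinAlgEquiv' (R := k) (n := ι)).toAlgHom.comp (FreeAlgebra.lift k A) =
      FreeAlgebra.lift k fun j => (Matrix.toLinAlgEquiv' (A j) : Module.End k (ι → k)) := by
    ext j : 2
    simp
  exact congrArg (fun φ => φ y) this

lemma IsSimpleTuple.exists_sum_mul_eq_one {A : Fin g → Matrix ι ι k}
    (hA : IsSimpleTuple A) (h0 : ∃ j, A j ≠ 0) :
    ∃ C : Fin g → Matrix ι ι k, ∑ j, A j * C j = 1 := by
  let φ : (Fin g → ι → k) →ₗ[k] (ι → k) := ∑ j, Matrix.toLin' (A j) ∘ₗ LinearMap.proj j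
  have hφ : ∀ c, φ c = ∑ j, A j *ᵥ c j := fun c => by simp [φ]
  have hsingle : ∀ j w, φ (Pi.single j w) = A j *ᵥ w := by
    intro j w
    rw [hφ, Finset.sum_eq_single j]
    · simp
    · intro l _ hl
      simp [hl]
    · simp
  have htop : LinearMap.range φ = ⊤ := by
    refine (hA (LinearMap.range φ) fun j w _ => LinearMap.mem_range.mpr
      ⟨Pi.single j w, hsingle j w⟩).resolve_left fun hbot => ?_
    obtain ⟨j, hj⟩ := h0
    refine hj (Matrix.ext_of_mulVec_single fun i => ?_)
    rw [← hsingle, LinearMap.range_eq_bot.mp hbot]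
    simp only [LinearMap.zero_apply, Matrix.mulVec_single_one]
    rfl
  choose c hc using fun i : ι => (LinearMap.range_eq_top.mp htop) (Pi.single i 1)
  refine ⟨fun j => Matrix.of fun a i => c i j a, Matrix.ext fun a i => ?_⟩
  have := congrFun (hc i) a
  rw [hφ] at this
  simp only [Finset.sum_apply, Matrix.sum_apply, Matrix.mul_apply, Matrix.mulVec, dotProduct,
    Matrix.of_apply] at this ⊢
  rw [this, Matrix.one_apply, Pi.single_apply]

end Burnside

section MultiplicityCurve

lemma pencilEval_map {R S S' : Type*} [CommRing R] [CommRing S] [Algebra R S] [CommRing S']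
    [Algebra R S'] {g : ℕ} {ι n : Type*} [Fintype ι] [DecidableEq ι] [Fintype n] [DecidableEq n]
    (φ : S →ₐ[R] S') (A : Fin g → Matrix ι ι R) (X : Fin g → Matrix n n S) :
    (pencilEval A X).map φ = pencilEval A fun j => (X j).map φ := by
  refine Matrix.ext fun p q => ?_
  simp [pencilEval, Matrix.sum_apply, Matrix.one_apply, apply_ite φ]

lemma det_pencilEval_map {R S S' : Type*} [CommRing R] [CommRing S] [Algebra R S] [CommRing S']
    [Algebra R S'] {g : ℕ} {ι n : Type*} [Fintype ι] [DecidableEq ι] [Fintype n] [DecidableEq n]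
    (φ : S →ₐ[R] S') (A : Fin g → Matrix ι ι R) (X : Fin g → Matrix n n S) :
    φ (pencilEval A X).det = (pencilEval A fun j => (X j).map φ).det := by
  rw [← pencilEval_map, AlgHom.map_det]
  rfl

lemma det_pencilEval_fromBlocks_zero {R S : Type*} [CommRing R] [CommRing S] [Algebra R S]
    {g : ℕ} {ι m n l : Type*} [Fintype ι] [DecidableEq ι] [Fintype n] [DecidableEq n] [Fintype m]
    [DecidableEq m] [Fintype l] [DecidableEq l] (e : m ⊕ l ≃ n)
    (A : Fin g → Matrix ι ι R) (X : Fin g → Matrix m m S) :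
    (pencilEval A fun j => Matrix.reindex e e (fromBlocks (X j) 0 0 0)).det =
      (pencilEval A X).det := by
  have h : fromBlocks (pencilEval A X) 0 0 (1 : Matrix (ι × l) (ι × l) S) =
      Matrix.reindex ((Equiv.prodCongr (Equiv.refl ι) e.symm).trans (Equiv.prodSumDistrib ι m l))
        ((Equiv.prodCongr (Equiv.refl ι) e.symm).trans (Equiv.prodSumDistrib ι m l))
        (pencilEval A fun j => Matrix.reindex e e (fromBlocks (X j) 0 0 0)) := by
    refine Matrix.ext fun p q => ?_
    rcases p with p | p <;> rcases q with q | q <;>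
      simp [pencilEval, Matrix.sum_apply, Matrix.one_apply, Prod.ext_iff]
  have h1 := congrArg Matrix.det h
  rwa [Matrix.det_fromBlocks_zero₂₁, det_one, mul_one, Matrix.det_reindex_self, eq_comm] at h1

lemma det_pencilEval_swap {k T : Type*} [CommRing k] [CommRing T] [Algebra k T]
    {g : ℕ} {ι n : Type*} [Fintype ι] [DecidableEq ι] [Fintype n] [DecidableEq n]
    (A : Fin g → Matrix ι ι k) (B : Fin g → Matrix n n T) :
    (pencilEval B fun j => (A j).map (algebraMap k T)).det = (pencilEval A B).det := by
  rw [← Matrix.det_reindex_self (Equiv.prodComm n ι)]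
  congr 1
  refine Matrix.ext fun p q => ?_
  simp [pencilEval, Matrix.sum_apply, Matrix.one_apply, Prod.ext_iff, Algebra.smul_def, mul_comm,
    and_comm]

variable {k : Type*} [Field k] {g : ℕ} {ι : Type} [Fintype ι] [DecidableEq ι]

lemma det_one_sub_smul_single {T : Type*} [CommRing T] (t : T) (i : ι) :
    (1 - t • Matrix.single i i (1 : T)).det = 1 - t := by
  have : 1 - t • Matrix.single i i (1 : T) =
      Matrix.diagonal fun l => if l = i then 1 - t else 1 := by
    refine Matrix.ext fun a b => ?_
    by_cases hab : a = b
    · subst hab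
      by_cases ha : a = i
      · simp [ha]
      · simp [ha, Ne.symm ha]
    · have : ¬ (i = a ∧ i = b) := fun h => hab (h.1.symm.trans h.2)
      simp [hab, this]
  rw [this, Matrix.det_diagonal, Finset.prod_ite_eq']
  simp

lemma irreducible_one_sub_X : Irreducible (1 - Polynomial.X : Polynomial k) := by
  refine Associated.irreducible ⟨-1, ?_⟩ (Polynomial.irreducible_X_sub_C (1 : k))
  simp

/-- A simple nonzero tuple admits polynomial matrix curves along which the determinant of its
monic pencil is a linear polynomial. -/
lemma IsSimpleTuple.exists_curve [IsAlgClosed k] {A : Fin g → Matrix ι ι k}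
    (hA : IsSimpleTuple A) (h0 : ∃ j, A j ≠ 0) :
    ∃ m : ℕ, ∀ n ≥ m, ∃ X : Fin g → Matrix (Fin n) (Fin n) (Polynomial k),
      Irreducible (pencilEval A X).det := by
  obtain ⟨i⟩ : Nonempty ι := by
    by_contra h
    rw [not_nonempty_iff] at h
    obtain ⟨j, hj⟩ := h0
    exact hj (Subsingleton.elim _ _)
  obtain ⟨c, hc⟩ := hA.exists_sum_mul_eq_one h0
  choose y hy using fun j => hA.exists_lift_eq (c j * Matrix.single i i 1)
  let T := Polynomial k
  let Y : Fin g → Matrix ι ι T := fun j => (A j).map (algebraMap k T)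
  let ψ : FreeAlgebra k (Fin g) →ₐ[k] FreeAlgebra T (Fin g) :=
    FreeAlgebra.lift k (FreeAlgebra.ι T)
  have hψ : ∀ z, FreeAlgebra.lift T Y (ψ z) = (FreeAlgebra.lift k A z).map (algebraMap k T) := by
    intro z
    have : ((FreeAlgebra.lift T Y).restrictScalars k).comp ψ =
        ((Algebra.ofId k T).mapMatrix (m := ι)).comp (FreeAlgebra.lift k A) := by
      ext j : 2
      simp [ψ, Y]
      rfl
    exact congrArg (fun φ => φ z) this
  let p : FreeAlgebra T (Fin g) :=
    1 - (Polynomial.X : T) • ∑ j, FreeAlgebra.ι T j * ψ (y j)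
  have hp : FreeAlgebra.lift T Y p = 1 - (Polynomial.X : T) • Matrix.single i i (1 : T) := by
    have : ∑ j, Y j * (c j * Matrix.single i i 1).map (algebraMap k T) =
        Matrix.single i i (1 : T) := by
      have h1 := congrArg (fun M => (algebraMap k T).mapMatrix (M * Matrix.single i i 1)) hc
      simp only [Finset.sum_mul, mul_assoc, map_sum, map_mul, one_mul] at h1
      refine Eq.trans (Finset.sum_congr rfl fun j _ => ?_) (h1.trans ?_)
      · rw [← map_mul]
        rfl
      · simp
    simp only [p, map_sub, map_one, map_smul, map_sum, map_mul, FreeAlgebra.lift_ι_apply, hψ, hy,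
      this]
  obtain ⟨κ, _, _, B, P, Q, hP, hQ, hPQ⟩ :=
    exists_monicPencil (Matrix.of fun _ _ : Unit => p) (by
      have : (Matrix.of fun _ _ : Unit => p).map
          (FreeAlgebra.lift T (fun _ : Fin g => (0 : T))) = 1 := by
        refine Matrix.ext fun _ _ => ?_
        simp [p]
      rw [this]
      exact isUnit_one)
  have hass := associated_det_monicPencil Y hP hQ hPQ
  have hdet : (matEvalHom Unit Y (Matrix.of fun _ _ : Unit => p)).det = 1 - Polynomial.X := by
    rw [← det_one_sub_smul_single (Polynomial.X : T) i, ← hp,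
      ← Matrix.det_reindex_self (Equiv.punitProd ι)]
    congr 1
  rw [hdet, det_pencilEval_swap] at hass
  refine ⟨Fintype.card (Unit ⊕ κ), fun n hn => ?_⟩
  let e : (Unit ⊕ κ) ⊕ Fin (n - Fintype.card (Unit ⊕ κ)) ≃ Fin n :=
    Fintype.equivFinOfCardEq (by
      rw [Fintype.card_sum, Fintype.card_fin]
      omega)
  refine ⟨fun j => Matrix.reindex e e (fromBlocks (B j) 0 0 0), ?_⟩
  rw [det_pencilEval_fromBlocks_zero]
  exact hass.irreducible irreducible_one_sub_X

end MultiplicityCurve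

section KernelVectors

variable {R S : Type*} [CommRing R] [CommRing S] [Algebra R S] {g : ℕ} {ι n : Type*} [Fintype ι]
  [DecidableEq ι] [Fintype n] [DecidableEq n]

lemma pencilEval_mulVec (A : Fin g → Matrix ι ι R) (X : Fin g → Matrix n n S) (V : Matrix ι n S) :
    pencilEval A X *ᵥ (fun p => V p.1 p.2) =
      fun p => (V - ∑ j, (A j).map (algebraMap R S) * V * (X j)ᵀ) p.1 p.2 := by
  have h : ∀ j, kroneckerMap (fun a x => a • x) (A j) (X j) *ᵥ (fun p => V p.1 p.2) =
      fun p => ((A j).map (algebraMap R S) * V * (X j)ᵀ) p.1 p.2 := by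
    intro j
    funext p
    simp only [Matrix.mulVec, dotProduct, Fintype.sum_prod_type, kroneckerMap_apply,
      Matrix.mul_apply, Matrix.map_apply, Matrix.transpose_apply, Finset.sum_mul, Algebra.smul_def]
    rw [Finset.sum_comm]
    exact Finset.sum_congr rfl fun b _ => Finset.sum_congr rfl fun a _ => by ring
  rw [pencilEval, Matrix.sub_mulVec, Matrix.one_mulVec, Matrix.sum_mulVec]
  funext p
  simp [h, Matrix.sum_apply]

lemma det_pencilEval_eq_zero_iff [IsDomain S] (A : Fin g → Matrix ι ι R)
    (X : Fin g → Matrix n n S) :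
    (pencilEval A X).det = 0 ↔
      ∃ V : Matrix ι n S, V ≠ 0 ∧ ∑ j, (A j).map (algebraMap R S) * V * (X j)ᵀ = V := by
  rw [← Matrix.exists_mulVec_eq_zero_iff]
  constructor
  · rintro ⟨v, hv, h⟩
    refine ⟨Matrix.of fun i j => v (i, j), fun hV => hv (funext fun p => ?_), ?_⟩
    · exact congrFun (congrFun hV p.1) p.2
    · have h1 := pencilEval_mulVec A X (Matrix.of fun i j => v (i, j))
      refine Matrix.ext fun i l => ?_
      have h2 := congrFun (h1.symm.trans h) (i, l)
      exact (sub_eq_zero.mp h2).symm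
  · rintro ⟨V, hV, h⟩
    refine ⟨fun p => V p.1 p.2, fun h0 => hV (Matrix.ext fun i l => congrFun h0 (i, l)), ?_⟩
    rw [pencilEval_mulVec, h, sub_self]
    rfl

end KernelVectors

section FullRankKernel

universe u

variable {k : Type u} [Field k] {g : ℕ} {ι : Type} [Fintype ι] [DecidableEq ι] {n : ℕ}

/-- Evaluation of commutative polynomials in the entries of generic matrices. -/
def evalGeneric {S : Type*} [CommRing S] [Algebra k S] (X : Fin g → Matrix (Fin n) (Fin n) S) :
    MvPolynomial (Fin g × Fin n × Fin n) k →ₐ[k] S :=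
  aeval fun p => X p.1 p.2.1 p.2.2

lemma evalGeneric_genX {S : Type*} [CommRing S] [Algebra k S]
    (X : Fin g → Matrix (Fin n) (Fin n) S) (j : Fin g) :
    (genX k g n j).map (evalGeneric X) = X j := by
  refine Matrix.ext fun a b => ?_
  simp [genX, evalGeneric]

lemma evalGeneric_det_pencilEval {S : Type*} [CommRing S] [Algebra k S] (A : Fin g → Matrix ι ι k)
    (X : Fin g → Matrix (Fin n) (Fin n) S) :
    evalGeneric X (pencilEval A (genX k g n)).det = (pencilEval A X).det := by
  rw [det_pencilEval_map]
  simp only [evalGeneric_genX]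

/-- A point with a full-rank kernel vector of the pencil `1 - ∑ A_j ⊗ X_j`. -/
def HasFullRankKernel {S : Type*} [CommRing S] [Algebra k S] (A : Fin g → Matrix ι ι k)
    (X : Fin g → Matrix (Fin n) (Fin n) S) : Prop :=
  ∃ (V : Matrix ι (Fin n) S) (W : Matrix (Fin n) ι S), V * W = 1 ∧
    ∑ j, (A j).map (algebraMap k S) * V * (X j)ᵀ = V

/-- The points with a full-rank kernel vector lie on the zero set of a prime ideal containing the
determinant of the pencil. -/
lemma exists_isPrime_of_hasFullRankKernel [Nonempty ι] {A C : Fin g → Matrix ι ι k}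
    (hAC : ∑ j, A j * C j = 1) {K₀ : Type u} [Field K₀] [Algebra k K₀]
    {X₀ : Fin g → Matrix (Fin n) (Fin n) K₀} (hX₀ : HasFullRankKernel A X₀) :
    ∃ I : Ideal (MvPolynomial (Fin g × Fin n × Fin n) k), I.IsPrime ∧
      (pencilEval A (genX k g n)).det ∈ I ∧
      ∀ (K : Type u) [Field K] [Algebra k K] (X : Fin g → Matrix (Fin n) (Fin n) K),
        HasFullRankKernel A X → ∀ p ∈ I, evalGeneric X p = 0 := by
  let σ := (Fin g × Fin n × Fin n) ⊕ (ι × Fin n) ⊕ (Fin n × ι)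
  let R₀ := MvPolynomial σ k
  let Z₀ : Fin g → Matrix (Fin n) (Fin n) R₀ := fun j =>
    Matrix.of fun a b => MvPolynomial.X (Sum.inl (j, a, b))
  let V₀ : Matrix ι (Fin n) R₀ := Matrix.of fun a b => MvPolynomial.X (Sum.inr (Sum.inl (a, b)))
  let W₀ : Matrix (Fin n) ι R₀ := Matrix.of fun a b => MvPolynomial.X (Sum.inr (Sum.inr (a, b)))
  let Δ := (V₀ * W₀).det
  have hspec : ∀ {K : Type u} [Field K] [Algebra k K] (Z : Fin g → Matrix (Fin n) (Fin n) K)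
      (V : Matrix ι (Fin n) K) (W : Matrix (Fin n) ι K), ∃ φ : R₀ →ₐ[k] K,
      (∀ j, (Z₀ j).map φ = Z j) ∧ V₀.map φ = V ∧ W₀.map φ = W := by
    intro K _ _ Z V W
    refine ⟨aeval (Sum.elim (fun p => Z p.1 p.2.1 p.2.2)
      (Sum.elim (fun p => V p.1 p.2) (fun p => W p.1 p.2))), fun j => ?_, ?_, ?_⟩ <;>
    · exact Matrix.ext fun a b => aeval_X _ _
  have hΔspec : ∀ {K : Type u} [Field K] [Algebra k K] (φ : R₀ →ₐ[k] K),
      V₀.map φ * W₀.map φ = 1 → φ Δ = 1 := by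
    intro K _ _ φ h
    have : φ Δ = (V₀.map φ * W₀.map φ).det := by
      rw [AlgHom.map_det, AlgHom.mapMatrix_apply, Matrix.map_mul]
    rw [this, h, det_one]
  have hΔ : Δ ≠ 0 := by
    intro h0
    obtain ⟨V, W, hVW, -⟩ := hX₀
    obtain ⟨φ, -, hV, hW⟩ := hspec (0 : Fin g → Matrix (Fin n) (Fin n) K₀) V W
    have := hΔspec φ (by rw [hV, hW, hVW])
    rw [h0, map_zero] at this
    exact zero_ne_one this
  let R := Localization.Away Δ
  have : IsDomain R := IsLocalization.isDomain_localization
    (powers_le_nonZeroDivisors_of_noZeroDivisors hΔ)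
  let i : R₀ →ₐ[k] R := (Algebra.ofId R₀ R).restrictScalars k
  let U := V₀.map i * W₀.map i
  have hU : IsUnit U.det := by
    have : U.det = algebraMap R₀ R Δ := by
      change _ = i Δ
      rw [AlgHom.map_det, AlgHom.mapMatrix_apply, Matrix.map_mul]
    rw [this]
    exact IsLocalization.Away.algebraMap_isUnit Δ
  let Y : Fin g → Matrix (Fin n) (Fin n) R := fun j => (Z₀ j).map i + W₀.map i * U⁻¹ *
    (C j).map (algebraMap k R) *
      (V₀.map i - ∑ l, (A l).map (algebraMap k R) * V₀.map i * (Z₀ l).map i)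
  refine ⟨RingHom.ker (evalGeneric fun j => (Y j)ᵀ), RingHom.ker_isPrime _, ?_, ?_⟩
  · rw [RingHom.mem_ker, evalGeneric_det_pencilEval, det_pencilEval_eq_zero_iff]
    have hVW : V₀.map i * (W₀.map i * U⁻¹) = 1 := by
      rw [← Matrix.mul_assoc, Matrix.mul_nonsing_inv _ hU]
    refine ⟨V₀.map i, fun h0 => ?_, ?_⟩
    · rw [h0, Matrix.zero_mul] at hVW
      exact zero_ne_one hVW
    · have hAC' : ∑ j, (A j).map (algebraMap k R) * (C j).map (algebraMap k R) = 1 := by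
        have := congrArg (algebraMap k R).mapMatrix hAC
        simp only [map_sum, map_mul, map_one] at this
        exact this
      have hterm : ∀ j, (A j).map (algebraMap k R) * V₀.map i * (Y j)ᵀᵀ =
          (A j).map (algebraMap k R) * V₀.map i * (Z₀ j).map i +
          (A j).map (algebraMap k R) * (C j).map (algebraMap k R) *
          (V₀.map i - ∑ l, (A l).map (algebraMap k R) * V₀.map i * (Z₀ l).map i) := by
        intro j
        rw [Matrix.transpose_transpose, Matrix.mul_add, ← Matrix.mul_assoc, ← Matrix.mul_assoc,
          Matrix.mul_assoc _ (V₀.map i) (W₀.map i * U⁻¹), hVW, Matrix.mul_one]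
      simp only [hterm]
      rw [Finset.sum_add_distrib, ← Matrix.sum_mul, hAC', Matrix.one_mul, add_sub_cancel]
  · rintro K _ _ X ⟨V, W, hVW, hV⟩ p hp
    obtain ⟨φ, hZ, hφV, hφW⟩ := hspec (fun j => (X j)ᵀ) V W
    have hΔ1 : φ Δ = 1 := hΔspec φ (by rw [hφV, hφW, hVW])
    let ρ : R →ₐ[k] K := IsLocalization.liftAlgHom (M := Submonoid.powers Δ) (f := φ) (by
      rintro ⟨_, m, rfl⟩
      simp [hΔ1])
    have hρ : ∀ x, ρ (i x) = φ x := fun x => IsLocalization.lift_eq _ x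
    have hmap : ∀ {a b : Type} (M : Matrix a b R₀), (M.map i).map ρ = M.map φ := by
      intro a b M
      refine Matrix.ext fun x y => hρ _
    have hA : ∀ {a b : Type} (M : Matrix a b k),
        (M.map (algebraMap k R)).map ρ = M.map (algebraMap k K) := by
      intro a b M
      refine Matrix.ext fun x y => ρ.commutes _
    have hY : ∀ j, (Y j).map ρ = (X j)ᵀ := by
      intro j
      have hS :
          (V₀.map i - ∑ l, (A l).map (algebraMap k R) * V₀.map i * (Z₀ l).map i).map ρ = 0 := by
        have : (∑ l, (A l).map (algebraMap k R) * V₀.map i * (Z₀ l).map i).map ρ =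
            ∑ l, ((A l).map (algebraMap k R) * V₀.map i * (Z₀ l).map i).map ρ := by
          refine Matrix.ext fun x y => ?_
          simp only [Matrix.map_apply, Matrix.sum_apply, map_sum]
        rw [Matrix.map_sub ρ (map_sub ρ), this]
        simp only [Matrix.map_mul, hmap, hA, hφV, hZ, hV, sub_self]
      rw [Matrix.map_add ρ (map_add ρ), Matrix.map_mul, hS, Matrix.mul_zero, add_zero, hmap, hZ]
    have hcomp : ρ.comp (evalGeneric fun j => (Y j)ᵀ) = evalGeneric X := by
      refine MvPolynomial.algHom_ext fun q => ?_
      have := congrFun (congrFun (hY q.1) q.2.2) q.2.1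
      simpa [evalGeneric] using this
    rw [← hcomp, AlgHom.comp_apply, (RingHom.mem_ker).mp hp, map_zero]

end FullRankKernel

section DimensionCount

lemma AlgebraicIndependent.card_le_of_forall_mem_adjoin {k K : Type*} [Field k] [Field K]
    [Algebra k K] {α β : Type} [Fintype α] [Fintype β] {x : α → K} (hx : AlgebraicIndependent k x)
    (y : β → K) (h : ∀ a, x a ∈ IntermediateField.adjoin k (Set.range y)) :
    Fintype.card α ≤ Fintype.card β := by
  have hind : (AlgebraicIndependent.matroid k K).Indep (Set.range x) :=
    AlgebraicIndependent.matroid_indep_iff.mpr hx.coe_range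
  have hsub : Set.range x ⊆ (AlgebraicIndependent.matroid k K).closure (Set.range y) := by
    rw [AlgebraicIndependent.matroid_closure_eq]
    rintro _ ⟨a, rfl⟩
    change IsAlgebraic (Algebra.adjoin k (Set.range y)) (x a)
    rw [← IntermediateField.isAlgebraic_adjoin_iff]
    exact isAlgebraic_algebraMap (⟨x a, h a⟩ : IntermediateField.adjoin k (Set.range y))
  have h1 := hind.encard_le_eRk_of_subset hsub
  rw [Matroid.eRk_closure_eq] at h1
  have h2 := h1.trans (Matroid.eRk_le_encard _ _)
  rw [← Set.image_univ, hx.injective.encard_image, ← Set.image_univ] at h2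
  have h3 := h2.trans (Set.encard_image_le _ _)
  simpa using h3

lemma exists_leftInverse_of_map_linearIndependent {L K : Type*} [Field L] [Field K] [Algebra L K]
    {m n : Type*} [Fintype m] [DecidableEq m] [Fintype n] [DecidableEq n] (B : Matrix m n L)
    (hB : LinearIndependent K (B.map (algebraMap L K)).col) : ∃ H : Matrix n m L, H * B = 1 := by
  rw [← Matrix.mulVec_injective_iff] at hB
  have hker : LinearMap.ker (Matrix.toLin' B) = ⊥ := by
    rw [LinearMap.ker_eq_bot']
    intro v hv
    have h1 : B.map (algebraMap L K) *ᵥ (algebraMap L K ∘ v) = 0 := by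
      funext i
      have := congrArg (algebraMap L K) (congrFun hv i)
      simpa [Matrix.mulVec, dotProduct] using this
    have h2 : algebraMap L K ∘ v = 0 := hB (by simpa using h1)
    funext i
    exact (algebraMap L K).injective (by simpa using congrFun h2 i)
  obtain ⟨φ, hφ⟩ := (Matrix.toLin' B).exists_leftInverse_of_injective hker
  refine ⟨LinearMap.toMatrix' φ, ?_⟩
  apply Matrix.toLin'.injective
  rw [Matrix.toLin'_mul, Matrix.toLin'_toMatrix', hφ, Matrix.toLin'_one]

variable {k K : Type*} [Field k] [Field K] [Algebra k K] {g : ℕ} {ι : Type} [Fintype ι]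
  [DecidableEq ι] {n : ℕ}

lemma IsSimpleTuple.eq_bot_or_eq_top_of_invariant [IsAlgClosed k] {A : Fin g → Matrix ι ι k}
    (hA : IsSimpleTuple A) (U : Submodule K (ι → K))
    (hU : ∀ j, ∀ u ∈ U, (A j).map (algebraMap k K) *ᵥ u ∈ U) : U = ⊥ ∨ U = ⊤ := by
  have hall : ∀ T : Matrix ι ι k, ∀ u ∈ U, T.map (algebraMap k K) *ᵥ u ∈ U := by
    intro T
    obtain ⟨y, rfl⟩ := hA.exists_lift_eq T
    induction y using FreeAlgebra.induction with
    | grade0 r =>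
      intro u hu
      rw [AlgHom.commutes, Matrix.algebraMap_eq_diagonal, Matrix.diagonal_map (map_zero _)]
      convert U.smul_mem (algebraMap k K r) hu using 1
      funext i
      simp [Matrix.mulVec_diagonal]
    | grade1 j => simpa using hU j
    | mul a b ha hb =>
      intro u hu
      rw [map_mul, Matrix.map_mul, ← Matrix.mulVec_mulVec]
      exact ha _ (hb _ hu)
    | add a b ha hb =>
      intro u hu
      rw [map_add, Matrix.map_add _ (map_add _), Matrix.add_mulVec]
      exact U.add_mem (ha _ hu) (hb _ hu)
  by_cases hbot : U = ⊥
  · exact Or.inl hbot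
  · right
    obtain ⟨u, hu, hu0⟩ := U.ne_bot_iff.mp hbot
    obtain ⟨i, hi⟩ := Function.ne_iff.mp hu0
    rw [eq_top_iff, ← (Pi.basisFun K ι).span_eq, Submodule.span_le]
    rintro _ ⟨c, rfl⟩
    have h1 := U.smul_mem (u i)⁻¹ (hall (Matrix.single c i 1) u hu)
    suffices h2 : Pi.basisFun K ι c =
        (u i)⁻¹ • (Matrix.single c i 1).map (algebraMap k K) *ᵥ u by
      rw [h2]
      exact h1
    funext l
    have hi' : u i ≠ 0 := hi
    by_cases hl : l = c
    · subst hl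
      simp [Matrix.mulVec, dotProduct, Matrix.single_apply, hi']
    · have hl' : c ≠ l := fun h => hl h.symm
      simp [Matrix.mulVec, dotProduct, hl, hl']

/-- If the pencil `1 - ∑ A_j ⊗ X_j` has a nonzero kernel vector but no full-rank one, then the
entries of `X` generate a field with few generators. -/
lemma IsSimpleTuple.exists_generators [IsAlgClosed k] {A : Fin g → Matrix ι ι k}
    (hA : IsSimpleTuple A) {X : Fin g → Matrix (Fin n) (Fin n) K} {V : Matrix ι (Fin n) K}
    (hV0 : V ≠ 0) (hV : ∑ j, (A j).map (algebraMap k K) * V * (X j)ᵀ = V)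
    (hW : ¬ ∃ W : Matrix (Fin n) ι K, V * W = 1) :
    ∃ (β : Type) (_ : Fintype β) (y : β → K),
      (∀ j a b, X j a b ∈ IntermediateField.adjoin k (Set.range y)) ∧
      Fintype.card β + n ≤ g * n * n + Fintype.card ι * Fintype.card ι := by
  classical
  let B : Matrix ι (Fin g × Fin n) K :=
    Matrix.of fun i p => ((A p.1).map (algebraMap k K) * V) i p.2
  let Z : Matrix (Fin g × Fin n) (Fin n) K := Matrix.of fun p c => X p.1 c p.2
  have hBZ : B * Z = V := by
    conv_rhs => rw [← hV]
    refine Matrix.ext fun i c => ?_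
    rw [Matrix.sum_apply, Matrix.mul_apply, Fintype.sum_prod_type]
    rfl
  obtain ⟨κ, a, ha, hspanV, hliV⟩ := exists_linearIndependent' K V.col
  obtain ⟨τ, J, hJ, hspanB, hliB⟩ := exists_linearIndependent' K B.col
  have : Fintype κ := Fintype.ofInjective a ha
  have : Fintype τ := Fintype.ofInjective J hJ
  let U := Submodule.span K (Set.range V.col)
  let U' := Submodule.span K (Set.range B.col)
  have hUU' : U ≤ U' := by
    refine Submodule.span_le.mpr ?_
    rintro _ ⟨c, rfl⟩
    have : V.col c = ∑ p, Z p c • B.col p := by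
      funext i
      conv_lhs => rw [← hBZ]
      simp [Matrix.mul_apply, Matrix.col, mul_comm]
    rw [this]
    exact Submodule.sum_mem _ fun p _ => Submodule.smul_mem _ _
      (Submodule.subset_span ⟨p, rfl⟩)
  have hU' : ∀ j, ∀ u ∈ U, (A j).map (algebraMap k K) *ᵥ u ∈ U' := by
    intro j u hu
    have : U ≤ U'.comap ((A j).map (algebraMap k K)).mulVecLin := by
      refine Submodule.span_le.mpr ?_
      rintro _ ⟨c, rfl⟩
      exact Submodule.subset_span ⟨(j, c), rfl⟩
    exact this hu
  have hlt : Module.finrank K U < Module.finrank K U' := by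
    by_contra! hle
    have heq : U = U' := Submodule.eq_of_le_of_finrank_le hUU' hle
    rcases hA.eq_bot_or_eq_top_of_invariant U (by rw [← heq] at hU'; exact hU') with h | h
    · refine hV0 (Matrix.ext fun i c => ?_)
      have : V.col c ∈ U := Submodule.subset_span ⟨c, rfl⟩
      rw [h, Submodule.mem_bot] at this
      exact congrFun this i
    · apply hW
      rw [← Matrix.mulVec_surjective_iff_exists_right_inverse]
      intro v
      have : v ∈ LinearMap.range V.mulVecLin := by
        rw [Matrix.range_mulVecLin]
        change v ∈ U
        rw [h]
        trivial
      exact this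
  have hfU : Module.finrank K U = Fintype.card κ := by
    rw [← finrank_span_eq_card hliV, hspanV]
  have hfU' : Module.finrank K U' = Fintype.card τ := by
    rw [← finrank_span_eq_card hliB, hspanB]
  have hκ : Fintype.card κ ≤ Fintype.card ι := by
    rw [← hfU, ← Module.finrank_fintype_fun_eq_card (R := K) (η := ι)]
    exact U.finrank_le
  have hVexp : ∃ W : Matrix κ (Fin n) K, V = V.submatrix id a * W := by
    have : ∀ c, ∃ w : κ → K, ∑ s, w s • V.col (a s) = V.col c := by
      intro c
      have : V.col c ∈ Submodule.span K (Set.range (V.col ∘ a)) := by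
        rw [hspanV]
        exact Submodule.subset_span ⟨c, rfl⟩
      exact (Submodule.mem_span_range_iff_exists_fun K).mp this
    choose w hw using this
    refine ⟨Matrix.of fun s c => w c s, Matrix.ext fun i c => ?_⟩
    have := congrFun (hw c) i
    simp only [Finset.sum_apply, Pi.smul_apply, smul_eq_mul, Matrix.col_apply] at this
    rw [← this, Matrix.mul_apply]
    exact Finset.sum_congr rfl fun s _ => mul_comm _ _
  obtain ⟨W, hVW⟩ := hVexp
  let y : (ι × κ) ⊕ (κ × Fin n) ⊕ ({p : Fin g × Fin n // p ∉ Set.range J} × Fin n) → K :=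
    Sum.elim (fun q => V q.1 (a q.2)) (Sum.elim (fun q => W q.1 q.2) fun q => Z q.1 q.2)
  let L := IntermediateField.adjoin k (Set.range y)
  have hy : ∀ q, y q ∈ L := fun q => IntermediateField.subset_adjoin k _ ⟨q, rfl⟩
  have hVL : ∀ i c, V i c ∈ L := by
    intro i c
    rw [hVW, Matrix.mul_apply]
    exact sum_mem fun s _ => mul_mem (hy (Sum.inl (i, s))) (hy (Sum.inr (Sum.inl (s, c))))
  have hBL : ∀ i p, B i p ∈ L := by
    intro i p
    change ((A p.1).map (algebraMap k K) * V) i p.2 ∈ L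
    rw [Matrix.mul_apply]
    exact sum_mem fun s _ => mul_mem (L.algebraMap_mem _) (hVL _ _)
  let BJ : Matrix ι τ L := Matrix.of fun i s => ⟨B i (J s), hBL i (J s)⟩
  have hBJ : BJ.map (algebraMap L K) = B.submatrix id J := rfl
  obtain ⟨H, hH⟩ := exists_leftInverse_of_map_linearIndependent (K := K) BJ (by
    rw [hBJ]
    exact hliB)
  have hHK : H.map (algebraMap L K) * B.submatrix id J = 1 := by
    rw [← hBJ, ← Matrix.map_mul, hH]
    exact Matrix.map_one _ (map_zero _) (map_one _)
  let Y : Matrix ι (Fin n) K := Matrix.of fun i c =>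
    V i c - ∑ p : {p : Fin g × Fin n // p ∉ Set.range J}, B i p * Z p c
  have hY : B.submatrix id J * Z.submatrix J id = Y := by
    refine Matrix.ext fun i c => ?_
    change _ = V i c - _
    rw [eq_sub_iff_add_eq]
    conv_rhs => rw [← hBZ]
    rw [Matrix.mul_apply, Matrix.mul_apply,
      ← Fintype.sum_subtype_add_sum_subtype (fun p => p ∈ Set.range J) fun p => B i p * Z p c]
    congr 1
    convert Fintype.sum_equiv (Equiv.ofInjective J hJ)
      (fun s => B.submatrix id J i s * Z.submatrix J id s c)
      (fun p => B i p * Z p c) fun s => rfl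
  have hZJ : Z.submatrix J id = H.map (algebraMap L K) * Y := by
    rw [← hY, ← Matrix.mul_assoc, hHK, Matrix.one_mul]
  have hZL : ∀ p c, Z p c ∈ L := by
    intro p c
    by_cases hp : p ∈ Set.range J
    · obtain ⟨s, rfl⟩ := hp
      have := congrFun (congrFun hZJ s) c
      rw [Matrix.submatrix_apply, id, Matrix.mul_apply] at this
      rw [this]
      refine sum_mem fun i _ => mul_mem (H s i).2 (sub_mem (hVL _ _) (sum_mem fun q _ => ?_))
      exact mul_mem (hBL _ _) (hy (Sum.inr (Sum.inr (q, c))))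
    · exact hy (Sum.inr (Sum.inr (⟨p, hp⟩, c)))
  refine ⟨_, inferInstance, y, fun j b c => hZL (j, c) b, ?_⟩
  have hcard : Fintype.card {p : Fin g × Fin n // p ∉ Set.range J} + Fintype.card τ = g * n := by
    rw [Fintype.card_congr (Equiv.ofInjective J hJ), add_comm, ← Fintype.card_sum,
      Fintype.card_congr (Equiv.sumCompl fun p => p ∈ Set.range J)]
    simp
  simp only [Fintype.card_sum, Fintype.card_prod, Fintype.card_fin]
  rw [hfU, hfU'] at hlt
  generalize Fintype.card {p : Fin g × Fin n // p ∉ Set.range J} = e at *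
  rw [← hcard]
  nlinarith [Nat.mul_le_mul_left (Fintype.card ι) hκ, Nat.mul_le_mul_right n hlt]

end DimensionCount

section GenericIrreducibility

lemma exists_algebraicIndependent_of_irreducible {σ k K : Type*} [Field k] [CommRing K]
    [Algebra k K] {q : MvPolynomial σ k} (hq : Irreducible q) (φ : MvPolynomial σ k →ₐ[k] K)
    (hφ : ∀ p, φ p = 0 ↔ q ∣ p) :
    ∃ i : σ, AlgebraicIndependent k fun s : {s // s ≠ i} => φ (MvPolynomial.X s.1) := by
  classical
  have hvars : q.vars.Nonempty := by
    rw [Finset.nonempty_iff_ne_empty]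
    intro h
    rw [MvPolynomial.vars_eq_empty_iff_eq_C] at h
    refine hq.not_isUnit ?_
    rw [h]
    refine (isUnit_iff_ne_zero.mpr fun h0 => ?_).map C
    rw [h0, map_zero] at h
    exact hq.ne_zero h
  obtain ⟨i, hi⟩ := hvars
  refine ⟨i, (injective_iff_map_eq_zero _).mpr fun h hh => ?_⟩
  have h1 : φ (rename Subtype.val h) = 0 := by
    rw [← hh]
    change (φ.comp (rename Subtype.val)) h = _
    congr 1
    refine MvPolynomial.algHom_ext fun s => ?_
    simp
  obtain ⟨r, hr⟩ := (hφ _).mp h1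
  by_contra hne
  have hne' : q * r ≠ 0 := by
    rw [← hr]
    exact fun h0 => hne (rename_injective _ Subtype.val_injective (by rw [h0, map_zero]))
  have hdeg := degreeOf_mul_eq (n := i) (left_ne_zero_of_mul hne') (right_ne_zero_of_mul hne')
  have h2 : degreeOf i (rename Subtype.val h) = 0 := by
    by_contra hd
    obtain ⟨s, -, hs⟩ := Finset.mem_image.mp
      (vars_rename _ _ (mem_vars_iff_degreeOf_ne_zero.mpr hd))
    exact s.2 hs
  have h3 := mem_vars_iff_degreeOf_ne_zero.mp hi
  rw [← hr, h2] at hdeg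
  omega

universe u

variable {k : Type u} [Field k] {g : ℕ} {ι : Type} [Fintype ι] [DecidableEq ι]
  {n : ℕ}

lemma IsSimpleTuple.hasFullRankKernel [IsAlgClosed k] {A : Fin g → Matrix ι ι k}
    (hA : IsSimpleTuple A) {K : Type u} [Field K] [Algebra k K] {X : Fin g → Matrix (Fin n) (Fin n) K}
    {q : MvPolynomial (Fin g × Fin n × Fin n) k} (hq : Irreducible q)
    (hX : ∀ p, evalGeneric X p = 0 ↔ q ∣ p) (hqA : q ∣ (pencilEval A (genX k g n)).det)
    (hn : Fintype.card ι * Fintype.card ι + 2 ≤ n) : HasFullRankKernel A X := by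
  have hdet := (hX _).mpr hqA
  rw [evalGeneric_det_pencilEval, det_pencilEval_eq_zero_iff] at hdet
  obtain ⟨V, hV0, hV⟩ := hdet
  by_contra hW
  obtain ⟨β, _, y, hy, hcard⟩ := hA.exists_generators hV0 hV
    fun ⟨W, h⟩ => hW ⟨V, W, h, hV⟩
  obtain ⟨i, hi⟩ := exists_algebraicIndependent_of_irreducible hq _ hX
  have h1 := hi.card_le_of_forall_mem_adjoin y fun s => by
    simpa [evalGeneric] using hy s.1.1 s.1.2.1 s.1.2.2
  have h2 : Fintype.card {s : Fin g × Fin n × Fin n // s ≠ i} = g * n * n - 1 := by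
    simp [Fintype.card_subtype_compl, mul_assoc]
  omega

lemma exists_evalGeneric_eq_zero_iff {q : MvPolynomial (Fin g × Fin n × Fin n) k}
    (hq : Irreducible q) : ∃ (K : Type u) (_ : Field K) (_ : Algebra k K)
      (X : Fin g → Matrix (Fin n) (Fin n) K), ∀ p, evalGeneric X p = 0 ↔ q ∣ p := by
  have hprime : (Ideal.span {q}).IsPrime :=
    (Ideal.span_singleton_prime hq.ne_zero).mpr hq.prime
  let R := MvPolynomial (Fin g × Fin n × Fin n) k ⧸ Ideal.span {q}
  let φ : MvPolynomial (Fin g × Fin n × Fin n) k →ₐ[k] FractionRing R :=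
    (IsScalarTower.toAlgHom k R (FractionRing R)).comp (Ideal.Quotient.mkₐ k _)
  refine ⟨FractionRing R, inferInstance, inferInstance, fun j => (genX k g n j).map φ, fun p => ?_⟩
  have h1 : evalGeneric (fun j => (genX k g n j).map φ) = φ := by
    refine MvPolynomial.algHom_ext fun s => ?_
    simp [evalGeneric, genX]
  rw [h1, ← Ideal.mem_span_singleton, ← Ideal.Quotient.eq_zero_iff_mem]
  exact map_eq_zero_iff _ (IsFractionRing.injective R (FractionRing R))

/-- The determinant of the generic evaluation of an irreducible pencil is irreducible in large
sizes. -/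
lemma IsSimpleTuple.exists_irreducible_det [IsAlgClosed k] {A : Fin g → Matrix ι ι k}
    (hA : IsSimpleTuple A) (h0 : ∃ j, A j ≠ 0) :
    ∃ m, ∀ n ≥ m, Irreducible (pencilEval A (genX k g n)).det := by
  obtain ⟨m, hm⟩ := hA.exists_curve h0
  refine ⟨max m (Fintype.card ι * Fintype.card ι + 2), fun n hn => ?_⟩
  obtain ⟨X, hX⟩ := hm n (le_of_max_le_left hn)
  have hn' := le_of_max_le_right hn
  obtain ⟨C, hC⟩ := hA.exists_sum_mul_eq_one h0
  have : Nonempty ι := by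
    obtain ⟨j, hj⟩ := h0
    by_contra h
    rw [not_nonempty_iff] at h
    exact hj (Subsingleton.elim _ _)
  rw [← evalGeneric_det_pencilEval] at hX
  set δ := (pencilEval A (genX k g n)).det
  have hδ0 : δ ≠ 0 := fun h => hX.ne_zero (by rw [h, map_zero])
  have hδu : ¬ IsUnit δ := fun h => hX.not_isUnit (h.map _)
  have hfull : ∀ q : MvPolynomial (Fin g × Fin n × Fin n) k, Irreducible q → q ∣ δ →
      ∃ (K : Type u) (_ : Field K) (_ : Algebra k K) (Y : Fin g → Matrix (Fin n) (Fin n) K),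
        HasFullRankKernel A Y ∧ ∀ p, evalGeneric Y p = 0 → q ∣ p := by
    intro q hq hqδ
    obtain ⟨K, _, _, Y, hY⟩ := exists_evalGeneric_eq_zero_iff hq
    exact ⟨K, _, _, Y, hA.hasFullRankKernel hq hY hqδ hn', fun p => (hY p).mp⟩
  obtain ⟨q, hq, hqδ⟩ := WfDvdMonoid.exists_irreducible_factor hδu hδ0
  obtain ⟨K, _, _, Y, hY, -⟩ := hfull q hq hqδ
  obtain ⟨I, hI, hδI, hvan⟩ := exists_isPrime_of_hasFullRankKernel hC hY
  have hdvd : ∀ q, Irreducible q → q ∣ δ → ∀ p ∈ I, q ∣ p := by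
    intro q hq hqδ p hp
    obtain ⟨K, _, _, Y, hY, hdvd⟩ := hfull q hq hqδ
    exact hdvd p (hvan K Y hY p hp)
  obtain ⟨s, hs, hsδ⟩ := WfDvdMonoid.exists_factors δ hδ0
  have hsI : ∃ p ∈ s, p ∈ I := by
    rw [← hI.multiset_prod_mem_iff_exists_mem]
    obtain ⟨c, hc⟩ := hsδ.symm
    rw [← hc]
    exact I.mul_mem_right _ hδI
  obtain ⟨p, hps, hpI⟩ := hsI
  have hp := hs p hps
  have hsp : ∀ r ∈ s, Associated r p := fun r hr =>
    (hs r hr).associated_of_dvd hp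
      (hdvd r (hs r hr) ((Multiset.dvd_prod hr).trans hsδ.dvd) p hpI)
  have hδp : ¬ p * p ∣ δ := by
    rintro ⟨c, hc⟩
    have hφp : IsUnit (evalGeneric X p) := by
      rw [hc, mul_assoc, map_mul] at hX
      refine (hX.isUnit_or_isUnit rfl).elim id fun h => ?_
      rw [map_mul] at h
      exact isUnit_of_mul_isUnit_left h
    refine hX.not_isUnit ((hsδ.map (evalGeneric X)).isUnit ?_)
    refine Multiset.prod_induction (fun x => IsUnit (evalGeneric X x)) s ?_ ?_ fun r hr =>
      ((hsp r hr).symm.map (evalGeneric X)).isUnit hφp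
    · intro a b ha hb
      rw [map_mul]
      exact ha.mul hb
    · simp
  obtain ⟨t, rfl⟩ := Multiset.exists_cons_of_mem hps
  rw [Multiset.prod_cons] at hsδ
  have ht : t = 0 := by
    by_contra ht
    obtain ⟨r, hr⟩ := Multiset.exists_mem_of_ne_zero ht
    exact hδp ((mul_dvd_mul_left p ((hsp r (Multiset.mem_cons_of_mem hr)).symm.dvd.trans
      (Multiset.dvd_prod hr))).trans hsδ.dvd)
  rw [ht, Multiset.prod_zero, mul_one] at hsδ
  exact hsδ.irreducible hp

end GenericIrreducibility

/-- If `f` is an atom of `M_d(k⟨x⟩)` with `f(0) = I`, then `det f(gX⁽ⁿ⁾)` is an irreducible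
polynomial for all sufficiently large `n`. -/
theorem det_atom_genericMatrices_irreducible
    {k : Type*} [Field k] [IsAlgClosed k] [CharZero k] {g d : ℕ}
    (f : Matrix (Fin d) (Fin d) (FreeAlgebra k (Fin g)))
    (hatom : MatAtom f)
    (h0 : f.map ⇑(FreeAlgebra.lift k (fun _ : Fin g => (0 : k))) = 1) :
    ∃ n₀ : ℕ, ∀ n ≥ n₀, Irreducible (matEval f (genX k g n)).det := by
  have hf : Irreducible f := ⟨hatom.1, fun u v h => hatom.2 u v h⟩
  obtain ⟨κ, _, _, A, P, Q, hP, hQ, hPQ⟩ := exists_monicPencil f (by rw [h0]; exact isUnit_one)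
  have hA : Irreducible (monicPencil A) := by
    obtain ⟨P, rfl⟩ := hP
    obtain ⟨Q, rfl⟩ := hQ
    rw [← hPQ, irreducible_mul_units, irreducible_units_mul]
    exact irreducible_fromBlocks_diag_one hf κ
  obtain ⟨ν, _, _, B, hB, hB0, hAB⟩ := exists_isSimpleTuple (fun n => genX k g n) _ A rfl hA
  obtain ⟨m, hm⟩ := hB.exists_irreducible_det hB0
  refine ⟨m, fun n hn => ?_⟩
  exact ((associated_det_monicPencil (genX k g n) hP hQ hPQ).trans (hAB n)).irreducible_iff.mpr
    (hm n hn)
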